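/- arXiv:1003.2218 — 5 statements merged into one kernel-verified Lean document; each statement's English description precedes it below -/
import Mathlib

section
/- Let Ω be a finite nonempty set, Λ ⊆ [0,∞]^Ω, Θ a nonempty countable set, P₀ : Θ → (0,1] with ∑_{θ∈Θ} P₀(θ) = 1, c ≥ 1 and η > 0 reals, and N ≥ 1. Let γ_n^θ ∈ Λ (1 ≤ n ≤ N, θ ∈ Θ) be the experts' predictions, ω_n ∈ Ω the outcomes, and γ_n ∈ Λ Learner's predictions, and set P_{n−1}(θ) := P₀(θ)·∏_{k=1}^{n−1} exp(−η·γ_k^θ(ω_k)). Suppose that for every n ∈ {1,…,N} and every ω ∈ Ω: exp(η·γ_n(ω)/c)·∑_{θ∈Θ} P_{n−1}(θ)·exp(−η·γ_n^θ(ω)) ≤ ∑_{θ∈Θ} P_{n−1}(θ) (the defining inequality of the Aggregating Algorithm). Then for every θ ∈ Θ: ∑_{n=1}^N γ_n(ω_n) ≤ c·∑_{n=1}^N γ_n^θ(ω_n) + (c/η)·ln(1/P₀(θ)), the inequality holding in [0,∞]. -/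
open scoped ENNReal BigOperators
open Filter

noncomputable section

variable {Ω : Type*} [Fintype Ω]

/-- `pexp r t = exp(r·t)` for `t ∈ [0,∞]`, with value `∞` when `t = ∞`. -/
def pexp (r : ℝ) (t : ℝ≥0∞) : ℝ≥0∞ :=
  if t = ∞ then ∞ else ENNReal.ofReal (Real.exp (r * t.toReal))

/-- `nexp r t = exp(−r·t)` for `t ∈ [0,∞]`, with value `0` when `t = ∞`. -/
def nexp (r : ℝ) (t : ℝ≥0∞) : ℝ≥0∞ :=
  if t = ∞ then 0 else ENNReal.ofReal (Real.exp (-(r * t.toReal)))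

/-- Expectation `E_π g = ∑_{ω : π ω ≠ 0} π(ω)·g(ω)` in `[0,∞]` (since `0·∞ = 0` in
`ℝ≥0∞`, the terms with `π ω = 0` contribute nothing, so we may sum over all `ω`). -/
def expect (π : Ω → ℝ) (g : Ω → ℝ≥0∞) : ℝ≥0∞ :=
  ∑ ω, ENNReal.ofReal (π ω) * g ω

/-- The superprediction set `Σ_Λ` of a game `(Ω, Λ)`. -/
def superpred (Λ : Set (Ω → ℝ≥0∞)) : Set (Ω → ℝ≥0∞) :=
  {g | ∃ γ ∈ Λ, ∀ ω, γ ω ≤ g ω}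

/-- `−(1/η)·ln x`, with value `∞` at `x = 0`. -/
def negLogDiv (η : ℝ) (x : ℝ≥0∞) : ℝ≥0∞ :=
  if x = 0 then ∞ else ENNReal.ofReal (-(1 / η) * Real.log x.toReal)

/-- The exp-convex hull `Σ_Λ^η` of the superprediction set. -/
def expHull (η : ℝ) (Λ : Set (Ω → ℝ≥0∞)) : Set (Ω → ℝ≥0∞) :=
  {g | ∃ k : ℕ, 0 < k ∧ ∃ (gs : Fin k → Ω → ℝ≥0∞) (ρ : Fin k → ℝ),
    (∀ i, gs i ∈ superpred Λ) ∧ (∀ i, 0 ≤ ρ i) ∧ (∑ i, ρ i = 1) ∧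
    ∀ ω, g ω = negLogDiv η (∑ i, ENNReal.ofReal (ρ i) * nexp η (gs i ω))}

/-- The set of minimal elements of `X`. -/
def minSet (X : Set (Ω → ℝ≥0∞)) : Set (Ω → ℝ≥0∞) :=
  {g | g ∈ X ∧ ∀ g' ∈ X, (∀ ω, g' ω ≤ g ω) → g' = g}

theorem pexp_ne_zero (r : ℝ) (t : ℝ≥0∞) : pexp r t ≠ 0 := by
  unfold pexp
  split_ifs
  · exact ENNReal.top_ne_zero
  · exact (ENNReal.ofReal_pos.2 (Real.exp_pos _)).ne'

theorem pexp_add (r : ℝ) (s t : ℝ≥0∞) : pexp r (s + t) = pexp r s * pexp r t := by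
  by_cases hs : s = ∞
  · subst hs
    rw [top_add, show pexp r ∞ = ∞ from if_pos rfl, ENNReal.top_mul (pexp_ne_zero r t)]
  by_cases ht : t = ∞
  · subst ht
    rw [add_top, show pexp r ∞ = ∞ from if_pos rfl, ENNReal.mul_top (pexp_ne_zero r s)]
  simp only [pexp, hs, ht, ENNReal.add_eq_top, or_self, if_false]
  rw [ENNReal.toReal_add hs ht, mul_add, Real.exp_add, ENNReal.ofReal_mul (Real.exp_pos _).le]

theorem nexp_add (r : ℝ) (s t : ℝ≥0∞) : nexp r (s + t) = nexp r s * nexp r t := by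
  by_cases hs : s = ∞
  · simp [nexp, hs]
  by_cases ht : t = ∞
  · simp [nexp, ht]
  simp only [nexp, hs, ht, ENNReal.add_eq_top, or_self, if_false]
  rw [ENNReal.toReal_add hs ht, mul_add, neg_add, Real.exp_add,
    ENNReal.ofReal_mul (Real.exp_pos _).le]

theorem nexp_sum {ι : Type*} (r : ℝ) (s : Finset ι) (f : ι → ℝ≥0∞) :
    nexp r (∑ i ∈ s, f i) = ∏ i ∈ s, nexp r (f i) := by
  classical
  induction s using Finset.induction_on with
  | empty => simp [nexp]
  | insert a s ha ih => rw [Finset.sum_insert ha, Finset.prod_insert ha, nexp_add, ih]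

/-- The bound obtained by taking logarithms in a product of exponential weights. -/
theorem le_of_pexp_mul_nexp_le_one {c η p : ℝ} (hc : 0 < c) (hη : 0 < η) (hp : 0 < p)
    {a b : ℝ≥0∞} (h : pexp (η / c) a * (ENNReal.ofReal p * nexp η b) ≤ 1) :
    a ≤ ENNReal.ofReal c * b + ENNReal.ofReal ((c / η) * Real.log (1 / p)) := by
  by_cases hb : b = ∞
  · rw [hb, ENNReal.mul_top (ENNReal.ofReal_pos.2 hc).ne', top_add]
    exact le_top
  have hw : ENNReal.ofReal p * nexp η b =
      ENNReal.ofReal (p * Real.exp (-(η * b.toReal))) := by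
    rw [nexp, if_neg hb, ENNReal.ofReal_mul hp.le]
  have hwpos : 0 < p * Real.exp (-(η * b.toReal)) := by positivity
  rw [hw] at h
  have ha : a ≠ ∞ := by
    rintro rfl
    rw [show pexp (η / c) ∞ = ∞ from if_pos rfl,
      ENNReal.top_mul (ENNReal.ofReal_pos.2 hwpos).ne'] at h
    exact absurd h (by simp)
  rw [pexp, if_neg ha, ← ENNReal.ofReal_mul (Real.exp_pos _).le, ENNReal.ofReal_le_one] at h
  have hlog := Real.log_nonpos (by positivity) h
  rw [Real.log_mul (Real.exp_pos _).ne' hwpos.ne', Real.log_mul hp.ne' (Real.exp_pos _).ne',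
    Real.log_exp, Real.log_exp] at hlog
  have hreal : a.toReal ≤ c * b.toReal + (c / η) * Real.log (1 / p) := by
    rw [one_div, Real.log_inv]
    have hmul := mul_nonpos_of_nonneg_of_nonpos (div_pos hc hη).le hlog
    have hexpand : c / η * (η / c * a.toReal + (Real.log p + -(η * b.toReal))) =
        a.toReal + c / η * Real.log p - c * b.toReal := by
      field_simp
      ring
    linarith
  calc a = ENNReal.ofReal a.toReal := (ENNReal.ofReal_toReal ha).symm
    _ ≤ ENNReal.ofReal (c * b.toReal + (c / η) * Real.log (1 / p)) :=
      ENNReal.ofReal_le_ofReal hreal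
    _ ≤ _ := ENNReal.ofReal_add_le
    _ = _ := by rw [ENNReal.ofReal_mul hc.le, ENNReal.ofReal_toReal hb]

/-- Theorem 1 of the paper (loss bound of the Aggregating Algorithm). -/
theorem aa_loss_bound
    {Ω : Type*} [Fintype Ω] [Nonempty Ω]
    (Λ : Set (Ω → ℝ≥0∞))
    {Θ : Type*} [Countable Θ] [Nonempty Θ]
    (P₀ : Θ → ℝ) (hP₀pos : ∀ θ, 0 < P₀ θ) (hP₀le : ∀ θ, P₀ θ ≤ 1)
    (hP₀sum : ∑' θ, ENNReal.ofReal (P₀ θ) = 1)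
    (c η : ℝ) (hc : 1 ≤ c) (hη : 0 < η)
    (N : ℕ) (hN : 1 ≤ N)
    (γE : ℕ → Θ → Ω → ℝ≥0∞) (hγE : ∀ n < N, ∀ θ, γE n θ ∈ Λ)
    (γL : ℕ → Ω → ℝ≥0∞) (hγL : ∀ n < N, γL n ∈ Λ)
    (ωs : ℕ → Ω)
    (P : ℕ → Θ → ℝ≥0∞)
    (hP : ∀ n θ, P n θ =
      ENNReal.ofReal (P₀ θ) * ∏ k ∈ Finset.range n, nexp η (γE k θ (ωs k)))
    (hAA : ∀ n < N, ∀ ω : Ω,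
      pexp (η / c) (γL n ω) * ∑' θ, P n θ * nexp η (γE n θ ω) ≤ ∑' θ, P n θ) :
    ∀ θ : Θ,
      ∑ n ∈ Finset.range N, γL n (ωs n) ≤
        ENNReal.ofReal c * ∑ n ∈ Finset.range N, γE n θ (ωs n) +
          ENNReal.ofReal ((c / η) * Real.log (1 / P₀ θ)) := by
  intro θ
  have htotal : ∀ n ≤ N,
      pexp (η / c) (∑ k ∈ Finset.range n, γL k (ωs k)) * ∑' θ, P n θ ≤ 1 := by
    intro n
    induction n with
    | zero => simp [pexp, hP, hP₀sum]
    | succ n ih =>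
      intro hn
      have hstep : ∀ θ, P (n + 1) θ = P n θ * nexp η (γE n θ (ωs n)) := fun θ ↦ by
        rw [hP, hP, Finset.prod_range_succ, mul_assoc]
      rw [Finset.sum_range_succ, pexp_add, mul_assoc, tsum_congr hstep]
      exact (mul_le_mul_right (hAA n hn (ωs n)) _).trans (ih (by lia))
  apply le_of_pexp_mul_nexp_le_one (by linarith) hη (hP₀pos θ)
  rw [nexp_sum, ← hP]
  exact (mul_le_mul_right (ENNReal.le_tsum θ) _).trans (htotal N le_rfl)
end
end

section
/- Let Ω be a finite nonempty set, Λ ⊆ [0,∞]^Ω with superprediction set Σ_Λ, let c ≥ 1 and η > 0 be reals, and let λ : 𝒫(Ω) → Σ_Λ be such that for every g ∈ Σ_Λ the function q_g(π,ω) := exp(η·λ(π)(ω)/c)·exp(−η·g(ω)) is forecast-continuous and has the supermartingale property. Let Θ be a nonempty countable set and P₀ : Θ → (0,1] with ∑_{θ∈Θ} P₀(θ) = 1. For expert predictions γ_n^θ ∈ Λ (n ≥ 1, θ ∈ Θ), decisions π_n ∈ 𝒫(Ω) and outcomes ω_n ∈ Ω define W_n := ∑_{θ∈Θ} P₀(θ)·∏_{k=1}^{n}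 exp(η·λ(π_k)(ω_k)/c)·exp(−η·γ_k^θ(ω_k)) (so W_0 = 1). Then: (i) for every n ≥ 1 and all values of γ_k^θ (k ≤ n), π_k and ω_k (k ≤ n−1), there exists π_n ∈ 𝒫(Ω) such that for every ω ∈ Ω, ∑_{θ∈Θ} P₀(θ)·(∏_{k=1}^{n−1} exp(η·λ(π_k)(ω_k)/c)·exp(−η·γ_k^θ(ω_k)))·exp(η·λ(π_n)(ω)/c)·exp(−η·γ_n^θ(ω)) ≤ W_{n−1}; (ii) if N ≥ 1 and π_1,…,π_N are such that W_n ≤ W_{n−1} for n = 1,…,N, then for every θ ∈ Θ: ∑_{n=1}^N λ(π_n)(ω_n) ≤ c·∑_{n=1}^N γ_n^θ(ω_n) + (c/η)·ln(1/P₀(θ)) in [0,∞]; consequently the same bound holds with ∑_{n=1}^N γ_n(ω_n) on the left for any γ_n ∈ Λ satisfying γ_n(ω) ≤ λ(π_n)(ω) for all ω. -/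
open scoped ENNReal BigOperators
open Filter

noncomputable section

variable {Ω : Type*} [Fintype Ω]

section NoRetraction

variable {E : Type*} [NormedAddCommGroup E] [InnerProductSpace ℝ E] [FiniteDimensional ℝ E]

/-- The determinant of `1 + A` is an affine combination, with coefficients independent of `A`, of
the determinants of `1 + v i • A`, for any `finrank + 1` distinct nodes `v i`. -/
lemma exists_det_one_add_eq_sum (v : Fin (Module.finrank ℝ E + 1) → ℝ)
    (hv : Function.Injective v) :
    ∃ a : Fin (Module.finrank ℝ E + 1) → ℝ, ∀ A : E →L[ℝ] E,
      (1 + A).det = ∑ i, a i * (1 + v i • A).det := by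
  refine ⟨fun i => (Lagrange.basis Finset.univ v i).eval 1, fun A => ?_⟩
  let b := Module.finBasis ℝ E
  let T := LinearMap.toMatrix b b (A : E →ₗ[ℝ] E)
  let p : Polynomial ℝ :=
    Matrix.det ((Polynomial.X : Polynomial ℝ) • T.map Polynomial.C +
      (1 : Matrix (Fin (Module.finrank ℝ E)) (Fin (Module.finrank ℝ E)) ℝ).map Polynomial.C)
  have hp : ∀ t, p.eval t = (1 + t • A).det := by
    intro t
    rw [ContinuousLinearMap.det, ← LinearMap.det_toMatrix b, ← Polynomial.coe_evalRingHom,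
      RingHom.map_det]
    congr 1
    ext i j
    rcases eq_or_ne i j with rfl | hij
    · simp [T, LinearMap.toMatrix_apply]
      ring
    · simp [T, LinearMap.toMatrix_apply, Matrix.one_apply_ne hij, hij]
      ring
  have hdeg : p.degree < (Finset.univ : Finset (Fin (Module.finrank ℝ E + 1))).card := by
    have := Polynomial.natDegree_det_X_add_C_le T 1
    rw [Finset.card_univ, Fintype.card_fin]
    refine lt_of_le_of_lt Polynomial.degree_le_natDegree ?_
    rw [Fintype.card_fin] at this
    exact_mod_cast Nat.lt_succ_of_le this
  have h1 := congrArg (Polynomial.eval 1) (Lagrange.eq_interpolate hv.injOn hdeg)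
  rw [Lagrange.interpolate_apply, Polynomial.eval_finsetSum, hp, one_smul] at h1
  simp only [Polynomial.eval_mul, Polynomial.eval_C, hp] at h1
  rw [h1]
  exact Finset.sum_congr rfl fun i _ => mul_comm _ _

lemma det_one_add_pos {A : E →L[ℝ] E} (hA : ‖A‖ < 1) : 0 < (1 + A).det := by
  have hne : ∀ t ∈ Set.Icc (0 : ℝ) 1, (1 + t • A).det ≠ 0 := by
    intro t ht h0
    obtain ⟨x, hx, hx0⟩ := Submodule.exists_mem_ne_zero_of_ne_bot
      (LinearMap.bot_lt_ker_of_det_eq_zero h0).ne'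
    have hx' : x + t • A x = 0 := hx
    have hxn : ‖x‖ = |t| * ‖A x‖ := by
      rw [← Real.norm_eq_abs, ← norm_smul, ← norm_neg (t • A x), ← eq_neg_of_add_eq_zero_left hx']
    rw [abs_of_nonneg ht.1] at hxn
    have h1 := A.le_opNorm x
    have h2 := norm_pos_iff.2 hx0
    nlinarith [mul_le_mul_of_nonneg_right ht.2 (norm_nonneg (A x))]
  have hcont : Continuous fun t : ℝ => (1 + t • A).det :=
    ContinuousLinearMap.continuous_det.comp (by fun_prop)
  by_contra! hneg
  have hivt := intermediate_value_Icc' (zero_le_one' ℝ) hcont.continuousOn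
  obtain ⟨t, ht, ht0⟩ := hivt (show (0 : ℝ) ∈ _ by
    refine ⟨by simpa using hneg, ?_⟩
    simp [ContinuousLinearMap.det])
  exact hne t ht ht0

/-- A small Lipschitz perturbation of the identity, supported in a ball, permutes that ball. -/
lemma bijOn_ball_of_lipschitz {g : E → E} {K : NNReal} (hg : LipschitzWith K g) (hK : K < 1)
    {M : ℝ} (hsupp : ∀ x, x ∉ Metric.ball (0 : E) M → g x = 0) :
    Set.BijOn (fun x => x + g x) (Metric.ball 0 M) (Metric.ball 0 M) := by
  have happ : ApproximatesLinearOn (fun x => x + g x)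
      (ContinuousLinearEquiv.refl ℝ E : E →L[ℝ] E) Set.univ K := by
    intro x _ y _
    have := hg.norm_sub_le x y
    simpa [add_sub_add_comm] using this
  have hc : Subsingleton E ∨
      K < ‖((ContinuousLinearEquiv.refl ℝ E).symm : E →L[ℝ] E)‖₊⁻¹ := by
    rcases subsingleton_or_nontrivial E with h | h
    · exact Or.inl h
    · right
      rw [ContinuousLinearEquiv.refl_symm, ContinuousLinearEquiv.coe_refl,
        ContinuousLinearMap.nnnorm_id, inv_one]
      exact hK
  have hinj : Function.Injective (fun x => x + g x) :=
    Set.injOn_univ.1 (happ.injOn hc)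
  have hsurj := happ.surjective hc
  have hfix : ∀ x, x ∉ Metric.ball (0 : E) M → x + g x = x := fun x hx => by simp [hsupp x hx]
  refine ⟨fun x hx => ?_, hinj.injOn, fun y hy => ?_⟩
  · by_contra hn
    have := hinj (hfix _ hn)
    exact hn (by simpa [this] using hx)
  · obtain ⟨x, rfl⟩ := hsurj y
    by_contra hn
    have hx : x ∉ Metric.ball (0 : E) M := fun hx => hn ⟨x, hx, rfl⟩
    exact hx (by simpa [hfix x hx] using hy)

end NoRetraction

section Projection

variable {E : Type*} [NormedAddCommGroup E] [InnerProductSpace ℝ E] [CompleteSpace E]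

/-- The metric projection onto a nonempty closed convex set. -/
lemma exists_metric_projection {K : Set E} (hne : K.Nonempty) (hcl : IsClosed K)
    (hconv : Convex ℝ K) :
    ∃ P : E → E, (∀ x, P x ∈ K) ∧ (∀ x, ∀ y ∈ K, inner ℝ (x - P x) (y - P x) ≤ 0) ∧
      LipschitzWith 1 P ∧ ∀ x ∈ K, P x = x := by
  choose P hPK hP using exists_norm_eq_iInf_of_complete_convex hne hcl.isComplete hconv
  have hP' : ∀ x, ∀ y ∈ K, inner ℝ (x - P x) (y - P x) ≤ 0 := fun x =>
    (norm_eq_iInf_iff_real_inner_le_zero hconv (hPK x)).1 (hP x)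
  refine ⟨P, hPK, hP', LipschitzWith.of_dist_le_mul fun x y => ?_, fun x hx => ?_⟩
  · have h1 := hP' x (P y) (hPK y)
    have h2 := hP' y (P x) (hPK x)
    have h3 : ‖P x - P y‖ ^ 2 ≤ inner ℝ (x - y) (P x - P y) := by
      rw [← real_inner_self_eq_norm_sq]
      simp only [inner_sub_left, inner_sub_right] at h1 h2 ⊢
      linarith
    have h4 := real_inner_le_norm (x - y) (P x - P y)
    rw [dist_eq_norm, dist_eq_norm, NNReal.coe_one, one_mul]
    nlinarith [norm_nonneg (P x - P y), norm_nonneg (x - y)]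
  · have h := hP' x x hx
    rw [real_inner_self_eq_norm_sq] at h
    have : ‖x - P x‖ = 0 := by nlinarith [norm_nonneg (x - P x)]
    exact (sub_eq_zero.1 (norm_eq_zero.1 this)).symm

end Projection

section NoRetraction

variable {E : Type*} [NormedAddCommGroup E] [InnerProductSpace ℝ E] [FiniteDimensional ℝ E]

lemma det_fderiv_eq_zero_of_norm_eq {h : E → E} (hh : ContDiff ℝ 1 h) {M : ℝ} (hM : 0 < M)
    (hnorm : ∀ x, ‖h x‖ = M) (x : E) : (fderiv ℝ h x).det = 0 := by
  have hd : HasFDerivAt h (fderiv ℝ h x) x := (hh.differentiable (by simp) x).hasFDerivAt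
  have h0 : ∀ v, inner ℝ (h x) (fderiv ℝ h x v) = 0 := by
    intro v
    have h1 := hd.norm_sq
    have h2 : (fun x => ‖h x‖ ^ 2) = fun _ => M ^ 2 := by simp [hnorm]
    rw [h2] at h1
    have h3 := congrArg (fun L => L v) (h1.unique (hasFDerivAt_const _ _))
    simpa using h3
  by_contra hdet
  have hsurj := ((fderiv ℝ h x : E →ₗ[ℝ] E).equivOfDetNeZero hdet).surjective
  obtain ⟨v, hv⟩ := hsurj (h x)
  have h4 := h0 v
  rw [show fderiv ℝ h x v = h x from hv, real_inner_self_eq_norm_sq, hnorm] at h4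
  exact absurd h4 (by positivity)

/-- There is no `C¹` retraction of a ball onto its boundary sphere. -/
lemma no_contDiff_retraction {h : E → E} (hh : ContDiff ℝ 1 h) {M : ℝ} (hM : 0 < M)
    (hnorm : ∀ x, ‖h x‖ = M) (hid : ∀ x, ‖x‖ = M → h x = x) : False := by
  borelize E
  let μ : MeasureTheory.Measure E := MeasureTheory.Measure.addHaar
  let B : Set E := Metric.ball 0 M
  let C : Set E := Metric.closedBall 0 M
  obtain ⟨P, hPC, hPinner, hPlip, hPid⟩ := exists_metric_projection (K := C)
    ⟨0, by simp [C, hM.le]⟩ Metric.isClosed_closedBall (convex_closedBall 0 M)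
  obtain ⟨K, hK⟩ := ((hh.sub contDiff_id).contDiffOn (s := C)).exists_lipschitzOnWith
    one_ne_zero (convex_closedBall 0 M) (isCompact_closedBall 0 M)
  let g : E → E := fun x => h (P x) - P x
  have hglip : LipschitzWith K g := by
    have := LipschitzOnWith.comp hK (hPlip.lipschitzOnWith (s := Set.univ)) (fun x _ => hPC x)
    rw [mul_one] at this
    exact lipschitzOnWith_univ.1 this
  have hgsupp : ∀ x, x ∉ B → g x = 0 := by
    intro x hx
    have hM' : ‖P x‖ = M := by
      refine le_antisymm (by simpa [C] using hPC x) ?_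
      by_contra! hlt
      let ε : ℝ := (M - ‖P x‖) / (1 + ‖x - P x‖)
      have hε : 0 < ε := div_pos (sub_pos.2 hlt) (by positivity)
      have hmem : P x + ε • (x - P x) ∈ C := by
        have h1 : ε * ‖x - P x‖ ≤ M - ‖P x‖ := by
          rw [div_mul_eq_mul_div, div_le_iff₀ (by positivity)]
          nlinarith
        have h2 := norm_add_le (P x) (ε • (x - P x))
        rw [norm_smul, Real.norm_of_nonneg hε.le] at h2
        simp only [C, mem_closedBall_zero_iff]
        linarith
      have h3 := hPinner x _ hmem
      rw [add_sub_cancel_left, inner_smul_right, real_inner_self_eq_norm_sq] at h3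
      have h4 : x - P x = 0 := by
        by_contra hne
        have := norm_pos_iff.2 hne
        exact absurd h3 (not_le.2 (by positivity))
      rw [← sub_eq_zero.1 h4] at hlt
      exact hx (by simpa [B] using hlt)
    simp [g, hid _ hM']
  have hgB : ∀ x ∈ B, HasFDerivAt g (fderiv ℝ h x - 1) x := by
    intro x hx
    have h1 : HasFDerivAt (fun y => h y - y) (fderiv ℝ h x - 1) x :=
      (hh.differentiable (by simp) x).hasFDerivAt.sub (hasFDerivAt_id x)
    refine h1.congr_of_eventuallyEq ?_
    filter_upwards [Metric.isOpen_ball.mem_nhds hx] with y hy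
    simp [g, hPid y (Metric.ball_subset_closedBall hy)]
  let D : E → E →L[ℝ] E := fun x => fderiv ℝ h x - 1
  have hDnorm : ∀ x ∈ B, ‖D x‖ ≤ K := fun x hx => by
    have := norm_fderiv_le_of_lipschitz ℝ hglip (x₀ := x)
    rwa [(hgB x hx).fderiv] at this
  have hDcont : Continuous D := (hh.continuous_fderiv (by simp)).sub continuous_const
  have hint : ∀ t : ℝ, MeasureTheory.IntegrableOn (fun x => (1 + t • D x).det) B μ := by
    intro t
    have : Continuous (fun x => (1 + t • D x).det) :=
      ContinuousLinearMap.continuous_det.comp (by fun_prop)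
    exact (this.continuousOn.integrableOn_compact (isCompact_closedBall 0 M)).mono_set
      Metric.ball_subset_closedBall
  have hvol : ∀ t : ℝ, |t| * K < 1 → ∫ x in B, (1 + t • D x).det ∂μ = μ.real B := by
    intro t ht
    have hlip : LipschitzWith (‖t‖₊ * K) (fun x => t • g x) :=
      (lipschitzWith_smul t).comp hglip
    have hbij := bijOn_ball_of_lipschitz hlip (M := M)
      (by rw [← NNReal.coe_lt_coe]; simpa using ht) (fun x hx => by simp [hgsupp x hx])
    have hcv := MeasureTheory.integral_image_eq_integral_abs_det_fderiv_smul μ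
      (s := B) (f := fun x => x + t • g x) (f' := fun x => 1 + t • D x) Metric.isOpen_ball.measurableSet
      (fun x hx => ((hasFDerivAt_id x).add ((hgB x hx).const_smul t)).hasFDerivWithinAt)
      hbij.injOn (fun _ => (1 : ℝ))
    rw [hbij.image_eq] at hcv
    simp only [smul_eq_mul, mul_one, MeasureTheory.integral_const,
      MeasureTheory.measureReal_restrict_apply_univ] at hcv
    rw [show μ.real B = _ from hcv]
    refine MeasureTheory.setIntegral_congr_fun Metric.isOpen_ball.measurableSet fun x hx => ?_
    refine (abs_of_pos (det_one_add_pos (A := t • D x) ?_)).symm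
    rw [norm_smul]
    exact lt_of_le_of_lt (mul_le_mul_of_nonneg_left (hDnorm x hx) (norm_nonneg _)) ht
  set n := Module.finrank ℝ E
  let s : ℝ := ((n + 1) * (K + 1))⁻¹
  have hs : 0 < s := by positivity
  let v : Fin (n + 1) → ℝ := fun i => s * i
  have hv : Function.Injective v := fun i j hij => by
    have := mul_left_cancel₀ hs.ne' hij
    exact Fin.ext (by exact_mod_cast this)
  have hvK : ∀ i, |v i| * K < 1 := by
    intro i
    have hi : (i : ℝ) < n + 1 := by exact_mod_cast i.2
    have hK0 : (0 : ℝ) ≤ K := K.2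
    rw [abs_of_nonneg (by positivity), mul_assoc, inv_mul_lt_one₀ (by positivity)]
    calc (i : ℝ) * K ≤ (n + 1) * K := by gcongr
      _ < (n + 1) * (K + 1) := by gcongr; linarith
  obtain ⟨a, ha⟩ := exists_det_one_add_eq_sum (E := E) v hv
  have hasum : ∑ i, a i = 1 := by
    have h0 := ha 0
    have h1 : (1 : E →L[ℝ] E).det = 1 := LinearMap.det_id
    simp only [smul_zero, add_zero, h1, mul_one] at h0
    exact h0.symm
  have hzero : ∀ x, (1 + D x).det = 0 := fun x => by
    rw [add_sub_cancel, det_fderiv_eq_zero_of_norm_eq hh hM hnorm x]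
  have h1 : ∫ x in B, (1 + D x).det ∂μ = μ.real B := by
    rw [funext fun x => ha (D x)]
    rw [MeasureTheory.integral_finsetSum _ fun i _ => (hint (v i)).const_mul _]
    simp_rw [MeasureTheory.integral_const_mul, fun i => hvol _ (hvK i)]
    rw [← Finset.sum_mul, hasum, one_mul]
  rw [funext hzero, MeasureTheory.integral_zero] at h1
  exact (ENNReal.toReal_pos (Metric.measure_ball_pos μ 0 hM).ne'
    MeasureTheory.measure_ball_lt_top.ne).ne h1

end NoRetraction

section BrouwerBounded

variable {E : Type*} [NormedAddCommGroup E] [InnerProductSpace ℝ E] [FiniteDimensional ℝ E]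

/-- A bounded continuous self-map of a finite-dimensional inner product space has a fixed point. -/
lemma exists_fixedPoint_of_continuous_of_bounded {w : E → E} (hw : Continuous w) {R : ℝ}
    (hR : ∀ x, ‖w x‖ ≤ R) : ∃ x, w x = x := by
  by_contra! hne
  have hR0 : 0 ≤ R := (norm_nonneg _).trans (hR 0)
  let χ : E → ℝ := fun x => max 0 (min 1 (R + 1 - ‖x‖))
  have hχ0 : ∀ x, 0 ≤ χ x := fun x => le_max_left _ _
  have hχ1 : ∀ x, χ x ≤ 1 := fun x => max_le zero_le_one (min_le_left _ _)
  let F : E → E := fun x => x - χ x • w x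
  have hF : Continuous F := by fun_prop
  have hF0 : ∀ x, F x ≠ 0 := by
    intro x hx
    have hx' : x = χ x • w x := sub_eq_zero.1 hx
    rcases le_or_gt ‖x‖ R with hle | hlt
    · have h1 : χ x = 1 := by
        have : min 1 (R + 1 - ‖x‖) = 1 := min_eq_left (by linarith)
        simp [χ, this]
      rw [h1, one_smul] at hx'
      exact hne x hx'.symm
    · have h1 := congrArg norm hx'
      rw [norm_smul, Real.norm_of_nonneg (hχ0 x)] at h1
      nlinarith [mul_le_mul_of_nonneg_right (hχ1 x) (norm_nonneg (w x)), hR x]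
  have hFid : ∀ x, R + 1 < ‖x‖ → F x = x := by
    intro x hx
    have : min 1 (R + 1 - ‖x‖) ≤ 0 := (min_le_right _ _).trans (by linarith)
    simp [F, χ, max_eq_left this]
  obtain ⟨G, hG, hGdist, hGeq, -⟩ := hF.exists_contDiff_approx_and_eqOn 1 (ε := fun x => ‖F x‖)
    hF.norm (fun x => norm_pos_iff.2 (hF0 x)) (S := {x | R + 2 ≤ ‖x‖}) (U := {x | R + 1 < ‖x‖})
    (isClosed_le continuous_const continuous_norm)
    ((isOpen_lt continuous_const continuous_norm).mem_nhdsSet.2 fun x hx => by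
      simp only [Set.mem_ofPred_eq] at hx ⊢; linarith)
    (contDiffOn_id.congr fun x hx => hFid x hx)
  have hG0 : ∀ x, G x ≠ 0 := by
    intro x hx
    have := hGdist x
    simp [hx] at this
  have hGid : ∀ x, ‖x‖ = R + 2 → G x = x := fun x hx => by
    rw [hGeq (show R + 2 ≤ ‖x‖ from hx.ge), hFid x (by linarith)]
  refine no_contDiff_retraction (h := fun x => ((R + 2) * ‖G x‖⁻¹) • G x) (M := R + 2) ?_
    (by positivity) (fun x => ?_) (fun x hx => ?_)
  · have hG1 : ContDiff ℝ 1 G := by exact_mod_cast hG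
    exact (contDiff_const.mul ((hG1.norm ℝ hG0).inv fun x => norm_ne_zero_iff.2 (hG0 x))).smul hG1
  · have := norm_pos_iff.2 (hG0 x)
    rw [norm_smul, Real.norm_of_nonneg (by positivity), mul_assoc, inv_mul_cancel₀ this.ne', mul_one]
  · have : R + 2 ≠ 0 := by positivity
    simp only [hGid x hx]
    rw [hx, mul_inv_cancel₀ this, one_smul]

/-- Existence of solutions of variational inequalities (Hartman–Stampacchia). -/
lemma exists_variational_inequality {K : Set E} (hne : K.Nonempty) (hK : IsCompact K)
    (hconv : Convex ℝ K) {v : E → E} (hv : ContinuousOn v K) :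
    ∃ p ∈ K, ∀ y ∈ K, inner ℝ (v p) (y - p) ≤ 0 := by
  obtain ⟨P, hPK, hP, hPlip, -⟩ := exists_metric_projection hne hK.isClosed hconv
  have hcont : ContinuousOn (fun x => x + v x) K := continuousOn_id.add hv
  obtain ⟨R, hR⟩ := hK.exists_bound_of_continuousOn hcont
  obtain ⟨x, hx⟩ := exists_fixedPoint_of_continuous_of_bounded
    (hcont.comp_continuous hPlip.continuous hPK) (fun x => hR (P x) (hPK x))
  refine ⟨P x, hPK x, fun y hy => ?_⟩
  have h1 : v (P x) = x - P x := eq_sub_of_add_eq' hx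
  rw [h1]
  exact hP x y hy

end BrouwerBounded

/-- For a continuous vector field `r` on the simplex, some point `π` satisfies
`r π ω ≤ E_π (r π)` for every `ω`. -/
lemma exists_mem_stdSimplex_forall_le_sum [Nonempty Ω] {r : (Ω → ℝ) → Ω → ℝ}
    (hr : ∀ ω, ContinuousOn (fun π => r π ω) (stdSimplex ℝ Ω)) :
    ∃ π ∈ stdSimplex ℝ Ω, ∀ ω, r π ω ≤ ∑ ω', π ω' * r π ω' := by
  classical
  let e : EuclideanSpace ℝ Ω ≃L[ℝ] (Ω → ℝ) := EuclideanSpace.equiv Ω ℝ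
  let K : Set (EuclideanSpace ℝ Ω) := e ⁻¹' stdSimplex ℝ Ω
  have hKc : IsCompact K := e.toHomeomorph.isCompact_preimage.2 (isCompact_stdSimplex ℝ Ω)
  have hKv : Convex ℝ K :=
    (convex_stdSimplex ℝ Ω).linear_preimage (e.toLinearEquiv : EuclideanSpace ℝ Ω →ₗ[ℝ] Ω → ℝ)
  have hKn : K.Nonempty :=
    ⟨e.symm _, by simpa [K] using single_mem_stdSimplex ℝ (Classical.arbitrary Ω)⟩
  have hv : ContinuousOn (fun x => e.symm (r (e x))) K :=
    e.symm.continuous.comp_continuousOn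
      ((continuousOn_pi.2 hr).comp e.continuous.continuousOn fun x hx => hx)
  obtain ⟨p, hp, hpK⟩ := exists_variational_inequality hKn hKc hKv hv
  refine ⟨e p, hp, fun ω => ?_⟩
  have h1 := hpK (e.symm (Pi.single ω 1)) (by simpa [K] using single_mem_stdSimplex ℝ ω)
  rw [inner_sub_right, sub_nonpos, PiLp.inner_apply, PiLp.inner_apply] at h1
  simpa [e, Pi.single_apply] using h1

lemma nexp_le_one {r : ℝ} (hr : 0 ≤ r) (t : ℝ≥0∞) : nexp r t ≤ 1 := by
  unfold nexp
  split_ifs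
  · exact zero_le_one
  · rw [ENNReal.ofReal_le_one, Real.exp_le_one_iff]
    have := mul_nonneg hr (ENNReal.toReal_nonneg (a := t))
    linarith

/-- A nonnegative mixture of functions with the supermartingale property admits a point of the
simplex at which the mixture is bounded by its total mass. -/
lemma exists_forall_tsum_mul_le [Nonempty Ω] {Θ : Type*} {f : (Ω → ℝ) → Ω → ℝ≥0∞}
    {a : Θ → Ω → ℝ≥0∞} (ha : ∀ θ ω, a θ ω ≤ 1)
    (hcont : ∀ θ ω, ContinuousOn (fun π => f π ω * a θ ω) (stdSimplex ℝ Ω))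
    (hsuper : ∀ θ, ∀ π ∈ stdSimplex ℝ Ω, expect π (fun ω => f π ω * a θ ω) ≤ 1)
    (w : Θ → ℝ≥0∞) :
    ∃ π ∈ stdSimplex ℝ Ω, ∀ ω, ∑' θ, w θ * (f π ω * a θ ω) ≤ ∑' θ, w θ := by
  set S : ℝ≥0∞ := ∑' θ, w θ with hS
  by_cases hSt : S = ∞
  · classical
    exact ⟨_, single_mem_stdSimplex ℝ (Classical.arbitrary Ω), fun ω => by simp [hSt]⟩
  let A : Ω → ℝ≥0∞ := fun ω => ∑' θ, w θ * a θ ω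
  have hAt : ∀ ω, A ω ≠ ∞ := fun ω =>
    ne_top_of_le_ne_top hSt (ENNReal.tsum_le_tsum fun θ => mul_le_of_le_one_right' (ha θ ω))
  have hfA : ∀ π ω, ∑' θ, w θ * (f π ω * a θ ω) = f π ω * A ω := fun π ω => by
    rw [← ENNReal.tsum_mul_left]
    exact tsum_congr fun θ => mul_left_comm _ _ _
  have hQcont : ∀ ω, ContinuousOn (fun π => f π ω * A ω) (stdSimplex ℝ Ω) := by
    intro ω
    by_cases hA0 : A ω = 0
    · simp only [hA0, mul_zero]
      exact continuousOn_const
    · obtain ⟨θ, hθ⟩ : ∃ θ, a θ ω ≠ 0 := by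
        by_contra! h
        exact hA0 (by simp [A, h])
      have hθt : a θ ω ≠ ∞ := ne_top_of_le_ne_top ENNReal.one_ne_top (ha θ ω)
      have h1 : ∀ π, f π ω * A ω = f π ω * a θ ω * ((a θ ω)⁻¹ * A ω) := fun π => by
        rw [mul_assoc, ← mul_assoc (a θ ω), ENNReal.mul_inv_cancel hθ hθt, one_mul]
      simp only [h1]
      exact (ENNReal.continuous_mul_const
        (ENNReal.mul_ne_top (ENNReal.inv_ne_top.2 hθ) (hAt ω))).comp_continuousOn (hcont θ ω)
  have hQsuper : ∀ π ∈ stdSimplex ℝ Ω, expect π (fun ω => f π ω * A ω) ≤ S := by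
    intro π hπ
    have h1 : expect π (fun ω => f π ω * A ω) =
        ∑' θ, w θ * expect π (fun ω => f π ω * a θ ω) := by
      simp only [expect, ← hfA, ← ENNReal.tsum_mul_left, Finset.mul_sum]
      rw [Summable.tsum_finsetSum fun _ _ => ENNReal.summable]
      exact Finset.sum_congr rfl fun ω _ => tsum_congr fun θ => mul_left_comm _ _ _
    rw [h1]
    exact ENNReal.tsum_le_tsum fun θ => mul_le_of_le_one_right' (hsuper θ π hπ)
  have hmt : ∀ x : ℝ≥0∞, min x (S + 1) ≠ ∞ := fun x =>
    ne_top_of_le_ne_top (ENNReal.add_ne_top.2 ⟨hSt, ENNReal.one_ne_top⟩) (min_le_right _ _)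
  obtain ⟨π, hπ, hle⟩ := exists_mem_stdSimplex_forall_le_sum
    (r := fun π ω => (min (f π ω * A ω) (S + 1)).toReal) fun ω =>
      ENNReal.continuousOn_toReal.comp ((hQcont ω).inf continuousOn_const) fun π _ => hmt _
  refine ⟨π, hπ, fun ω => ?_⟩
  rw [hfA]
  have hmin : min (f π ω * A ω) (S + 1) ≤ S := by
    rw [← ENNReal.toReal_le_toReal (hmt _) hSt]
    refine (hle ω).trans ?_
    have h1 : ∑ ω', π ω' * (min (f π ω' * A ω') (S + 1)).toReal =
        (expect π fun ω' => min (f π ω' * A ω') (S + 1)).toReal := by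
      rw [expect, ENNReal.toReal_sum fun ω' _ => ENNReal.mul_ne_top ENNReal.ofReal_ne_top (hmt _)]
      refine Finset.sum_congr rfl fun ω' _ => ?_
      rw [ENNReal.toReal_mul, ENNReal.toReal_ofReal (hπ.1 ω')]
    rw [h1]
    refine ENNReal.toReal_mono hSt (le_trans ?_ (hQsuper π hπ))
    exact Finset.sum_le_sum fun ω' _ => mul_le_mul_right (min_le_left _ _) _
  rcases min_le_iff.1 hmin with h | h
  · exact h
  · exact absurd h (not_le.2 (ENNReal.lt_add_right hSt one_ne_zero))

/-- If the weighted product of the exponentiated loss differences is at most `1`, the cumulative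
losses satisfy the corresponding additive bound. -/
lemma sum_le_of_mul_prod_le_one {c η P : ℝ} (hc : 0 < c) (hη : 0 < η) (hP : 0 < P) {ι : Type*}
    (s : Finset ι) (l g : ι → ℝ≥0∞)
    (h : ENNReal.ofReal P * ∏ k ∈ s, (pexp (η / c) (l k) * nexp η (g k)) ≤ 1) :
    ∑ k ∈ s, l k ≤ ENNReal.ofReal c * ∑ k ∈ s, g k +
      ENNReal.ofReal ((c / η) * Real.log (1 / P)) := by
  by_cases hg : ∀ k ∈ s, g k ≠ ∞
  swap
  · push Not at hg
    obtain ⟨k, hk, hgk⟩ := hg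
    rw [ENNReal.sum_eq_top.2 ⟨k, hk, hgk⟩, ENNReal.mul_top (ENNReal.ofReal_pos.2 hc).ne', top_add]
    exact le_top
  have hn : ∀ k ∈ s, nexp η (g k) = ENNReal.ofReal (Real.exp (-(η * (g k).toReal))) :=
    fun k hk => if_neg (hg k hk)
  have hl : ∀ k ∈ s, l k ≠ ∞ := by
    intro k hk hlk
    have h0 : ∀ j ∈ s, pexp (η / c) (l j) * nexp η (g j) ≠ 0 := by
      intro j hj
      rw [hn j hj]
      refine mul_ne_zero ?_ (ENNReal.ofReal_pos.2 (Real.exp_pos _)).ne'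
      unfold pexp
      split_ifs
      · exact ENNReal.top_ne_zero
      · exact (ENNReal.ofReal_pos.2 (Real.exp_pos _)).ne'
    have htop : ∏ j ∈ s, (pexp (η / c) (l j) * nexp η (g j)) = ∞ := by
      classical
      rw [← Finset.mul_prod_erase s _ hk, hn k hk, pexp, if_pos hlk,
        ENNReal.top_mul (ENNReal.ofReal_pos.2 (Real.exp_pos _)).ne',
        ENNReal.top_mul (Finset.prod_ne_zero_iff.2 fun j hj => h0 j (Finset.mem_of_mem_erase hj))]
    rw [htop, ENNReal.mul_top (ENNReal.ofReal_pos.2 hP).ne'] at h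
    exact ENNReal.one_ne_top (top_le_iff.1 h)
  have hprod : ENNReal.ofReal P * ∏ k ∈ s, (pexp (η / c) (l k) * nexp η (g k)) =
      ENNReal.ofReal (P * Real.exp (∑ k ∈ s, (η / c * (l k).toReal + -(η * (g k).toReal)))) := by
    rw [Real.exp_sum, ENNReal.ofReal_mul hP.le,
      ENNReal.ofReal_prod_of_nonneg fun k _ => (Real.exp_pos _).le]
    congr 1
    refine Finset.prod_congr rfl fun k hk => ?_
    rw [hn k hk, pexp, if_neg (hl k hk), ← ENNReal.ofReal_mul (Real.exp_pos _).le, Real.exp_add]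
  rw [hprod, ENNReal.ofReal_le_one] at h
  have hlog := Real.log_nonpos (by positivity) h
  rw [Real.log_mul hP.ne' (Real.exp_pos _).ne', Real.log_exp, Finset.sum_add_distrib,
    Finset.sum_neg_distrib, ← Finset.mul_sum, ← Finset.mul_sum, ← ENNReal.toReal_sum hl,
    ← ENNReal.toReal_sum hg] at hlog
  have hLt : ∑ k ∈ s, l k ≠ ∞ := ENNReal.sum_ne_top.2 hl
  have hGt : ∑ k ∈ s, g k ≠ ∞ := ENNReal.sum_ne_top.2 hg
  set L := ∑ k ∈ s, l k
  set G := ∑ k ∈ s, g k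
  have hreal : L.toReal ≤ c * G.toReal + (c / η) * Real.log (1 / P) := by
    rw [one_div, Real.log_inv]
    have h1 : L.toReal = (c / η) * (η / c * L.toReal) := by field_simp
    have h2 : c * G.toReal = (c / η) * (η * G.toReal) := by field_simp
    rw [h1, h2, ← mul_add]
    exact mul_le_mul_of_nonneg_left (by linarith) (by positivity)
  calc L = ENNReal.ofReal L.toReal := (ENNReal.ofReal_toReal hLt).symm
    _ ≤ ENNReal.ofReal (c * G.toReal + (c / η) * Real.log (1 / P)) :=
      ENNReal.ofReal_le_ofReal hreal
    _ ≤ ENNReal.ofReal (c * G.toReal) + ENNReal.ofReal ((c / η) * Real.log (1 / P)) :=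
      ENNReal.ofReal_add_le
    _ = _ := by rw [ENNReal.ofReal_mul hc.le, ENNReal.ofReal_toReal hGt]

/-- Theorem 2 of the paper (the Defensive Forecasting Algorithm and its loss bound). -/
theorem dfa_loss_bound
    {Ω : Type*} [Fintype Ω] [Nonempty Ω]
    (Λ : Set (Ω → ℝ≥0∞))
    (c η : ℝ) (hc : 1 ≤ c) (hη : 0 < η)
    (lam : (Ω → ℝ) → Ω → ℝ≥0∞)
    (hlam : ∀ π ∈ stdSimplex ℝ Ω, lam π ∈ superpred Λ)
    (hqcont : ∀ g ∈ superpred Λ, ∀ ω : Ω,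
      ContinuousOn (fun π => pexp (η / c) (lam π ω) * nexp η (g ω)) (stdSimplex ℝ Ω))
    (hqsuper : ∀ g ∈ superpred Λ, ∀ π ∈ stdSimplex ℝ Ω,
      expect π (fun ω => pexp (η / c) (lam π ω) * nexp η (g ω)) ≤ 1)
    {Θ : Type*} [Countable Θ] [Nonempty Θ]
    (P₀ : Θ → ℝ) (hP₀pos : ∀ θ, 0 < P₀ θ) (hP₀le : ∀ θ, P₀ θ ≤ 1)
    (hP₀sum : ∑' θ, ENNReal.ofReal (P₀ θ) = 1)
    (γE : ℕ → Θ → Ω → ℝ≥0∞) (hγE : ∀ n θ, γE n θ ∈ Λ)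
    (πs : ℕ → Ω → ℝ) (hπs : ∀ n, πs n ∈ stdSimplex ℝ Ω)
    (ωs : ℕ → Ω)
    (W : ℕ → ℝ≥0∞)
    (hW : ∀ n, W n = ∑' θ, ENNReal.ofReal (P₀ θ) *
      ∏ k ∈ Finset.range n,
        (pexp (η / c) (lam (πs k) (ωs k)) * nexp η (γE k θ (ωs k)))) :
    -- (i) a suitable next decision always exists
    (∀ n : ℕ, ∃ πn ∈ stdSimplex ℝ Ω, ∀ ω : Ω,
      (∑' θ, ENNReal.ofReal (P₀ θ) *
        (∏ k ∈ Finset.range n,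
          (pexp (η / c) (lam (πs k) (ωs k)) * nexp η (γE k θ (ωs k)))) *
        (pexp (η / c) (lam πn ω) * nexp η (γE n θ ω))) ≤ W n) ∧
    -- (ii) the loss bound
    (∀ N : ℕ, 1 ≤ N → (∀ n < N, W (n + 1) ≤ W n) → ∀ θ : Θ,
      (∑ n ∈ Finset.range N, lam (πs n) (ωs n) ≤
        ENNReal.ofReal c * ∑ n ∈ Finset.range N, γE n θ (ωs n) +
          ENNReal.ofReal ((c / η) * Real.log (1 / P₀ θ))) ∧
      (∀ γL : ℕ → Ω → ℝ≥0∞, (∀ n < N, γL n ∈ Λ) →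
        (∀ n < N, ∀ ω, γL n ω ≤ lam (πs n) ω) →
        ∑ n ∈ Finset.range N, γL n (ωs n) ≤
          ENNReal.ofReal c * ∑ n ∈ Finset.range N, γE n θ (ωs n) +
            ENNReal.ofReal ((c / η) * Real.log (1 / P₀ θ)))) := by
  constructor
  · intro n
    obtain ⟨π, hπ, hle⟩ := exists_forall_tsum_mul_le
      (f := fun π ω => pexp (η / c) (lam π ω)) (a := fun θ ω => nexp η (γE n θ ω))
      (fun θ ω => nexp_le_one hη.le _)
      (fun θ => hqcont _ ⟨γE n θ, hγE n θ, fun _ => le_rfl⟩)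
      (fun θ => hqsuper _ ⟨γE n θ, hγE n θ, fun _ => le_rfl⟩)
      (fun θ => ENNReal.ofReal (P₀ θ) * ∏ k ∈ Finset.range n,
        (pexp (η / c) (lam (πs k) (ωs k)) * nexp η (γE k θ (ωs k))))
    exact ⟨π, hπ, fun ω => (hle ω).trans_eq (hW n).symm⟩
  · intro N _ hmono θ
    have hW0 : W 0 = 1 := by simp [hW 0, hP₀sum]
    have hWN : ∀ n ≤ N, W n ≤ 1 := by
      intro n
      induction n with
      | zero => exact fun _ => hW0.le
      | succ n ih => exact fun hn => (hmono n hn).trans (ih (Nat.le_of_succ_le hn))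
    have hbound := sum_le_of_mul_prod_le_one (zero_lt_one.trans_le hc) hη (hP₀pos θ)
      (Finset.range N) (fun k => lam (πs k) (ωs k)) (fun k => γE k θ (ωs k))
      ((ENNReal.le_tsum θ).trans ((hW N).symm.trans_le (hWN N le_rfl)))
    exact ⟨hbound, fun γL _ hγL => (Finset.sum_le_sum fun n hn =>
      hγL n (Finset.mem_range.1 hn) (ωs n)).trans hbound⟩
end
end

section
/- For every η ∈ (0,2] and all p, q ∈ [0,1]: p·exp(η·((p−1)² − (q−1)²)) + (1−p)·exp(η·(p² − q²)) ≤ 1. (This is the supermartingale property of the exponential square-loss regret process exp(η·∑_n ((p_n−ω_n)² − (q_n−ω_n)²)) in the binary square loss game.) -/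
open scoped ENNReal BigOperators
open Filter

noncomputable section

variable {Ω : Type*} [Fintype Ω]

open MeasureTheory ProbabilityTheory in
/-- Hoeffding's lemma for a centered Bernoulli variable with parameter `p`. -/
theorem bernoulli_centered_mgf_le {p : ℝ} (hp0 : 0 ≤ p) (hp1 : p ≤ 1) (t : ℝ) :
    p * Real.exp (t * (1 - p)) + (1 - p) * Real.exp (t * (0 - p)) ≤ Real.exp (t ^ 2 / 8) := by
  have hp1' : 0 ≤ 1 - p := sub_nonneg.2 hp1
  let μ : Measure ℝ :=
    ENNReal.ofReal p • Measure.dirac 1 + ENNReal.ofReal (1 - p) • Measure.dirac 0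
  have hμ : IsProbabilityMeasure μ := ⟨by
    simp [μ, ← ENNReal.ofReal_add hp0 hp1']⟩
  have hint (f : ℝ → ℝ) : ∫ x, f x ∂μ = p * f 1 + (1 - p) * f 0 := by
    have hf (a : ℝ) : Integrable f (Measure.dirac a) := integrable_dirac (by simp)
    rw [integral_add_measure ((hf 1).smul_measure ENNReal.ofReal_ne_top)
      ((hf 0).smul_measure ENNReal.ofReal_ne_top)]
    simp [integral_smul_measure, hp0, hp1']
  have hmem : ∀ᵐ x ∂μ, (id x : ℝ) ∈ Set.Icc (0 : ℝ) 1 := by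
    rw [ae_add_measure_iff]
    constructor <;> apply Measure.ae_smul_measure <;> simp [ae_dirac_eq]
  have h := (hasSubgaussianMGF_of_mem_Icc aemeasurable_id hmem).mgf_le t
  rw [mgf, hint, hint] at h
  norm_num at h
  convert h using 2 <;> ring_nf

/-- Lemma 3 of the paper: the supermartingale property for the binary
square loss game. -/
theorem square_loss_supermartingale
    (η p q : ℝ) (hη0 : 0 < η) (hη2 : η ≤ 2)
    (hp0 : 0 ≤ p) (hp1 : p ≤ 1) (hq0 : 0 ≤ q) (hq1 : q ≤ 1) :
    p * Real.exp (η * ((p - 1) ^ 2 - (q - 1) ^ 2)) +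
      (1 - p) * Real.exp (η * (p ^ 2 - q ^ 2)) ≤ 1 := by
  have h := bernoulli_centered_mgf_le hp0 hp1 (2 * η * (q - p))
  have h₁ : Real.exp (η * ((p - 1) ^ 2 - (q - 1) ^ 2)) =
      Real.exp (-(η * (q - p) ^ 2)) * Real.exp (2 * η * (q - p) * (1 - p)) := by
    rw [← Real.exp_add]; ring_nf
  have h₀ : Real.exp (η * (p ^ 2 - q ^ 2)) =
      Real.exp (-(η * (q - p) ^ 2)) * Real.exp (2 * η * (q - p) * (0 - p)) := by
    rw [← Real.exp_add]; ring_nf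
  have hexp : -(η * (q - p) ^ 2) + (2 * η * (q - p)) ^ 2 / 8 ≤ 0 := by
    nlinarith [mul_nonneg (mul_nonneg hη0.le (sub_nonneg.2 hη2)) (sq_nonneg (q - p))]
  calc
    _ = Real.exp (-(η * (q - p) ^ 2)) * (p * Real.exp (2 * η * (q - p) * (1 - p)) +
        (1 - p) * Real.exp (2 * η * (q - p) * (0 - p))) := by rw [h₁, h₀]; ring
    _ ≤ Real.exp (-(η * (q - p) ^ 2)) * Real.exp ((2 * η * (q - p)) ^ 2 / 8) := by gcongr
    _ ≤ 1 := by rw [← Real.exp_add]; exact Real.exp_le_one_iff.2 hexp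
end
end

section
/- Let Ω be a finite nonempty set and E a nonempty set. Let S : List (E × 𝒫(Ω) × Ω) → ℝ be a forecast-continuous supermartingale, i.e.: (a) for every list h of triples in E × 𝒫(Ω) × Ω, every e ∈ E and every π ∈ 𝒫(Ω), ∑_{ω∈Ω} π(ω)·S(h ++ [(e,π,ω)]) ≤ S(h); and (b) for every such h, every e ∈ E and every ω ∈ Ω, the map π ↦ S(h ++ [(e,π,ω)]) is continuous on 𝒫(Ω). Then for every list h and every e ∈ E there exists π ∈ 𝒫(Ω) such that S(h ++ [(e,π,ω)]) ≤ S(h) for all ω ∈ Ω. -/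
open scoped ENNReal BigOperators
open Filter

noncomputable section

variable {Ω : Type*} [Fintype Ω]

section Scarf

/-- `Dominant u S` says that every point `y` is, for some order `u i`, below all of `S`. -/
def Dominant {I X : Type*} (u : I → X → ℕ) (S : Finset X) : Prop :=
  ∀ y, ∃ i, ∀ x ∈ S, u i y ≤ u i x

theorem Dominant.mono {I X : Type*} {u : I → X → ℕ} {S T : Finset X}
    (hS : Dominant u S) (h : T ⊆ S) : Dominant u T := fun y =>
  (hS y).imp fun _ hi x hx => hi x (h hx)

open Classical in
/-- A dominant set with one element fewer than there are orders has exactly two dominant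
one-point extensions, provided it does not lie on the boundary. -/
theorem Dominant.card_extensions_eq_two {I X : Type*} [Fintype I] [Fintype X]
    {u : I → X → ℕ} (hu : ∀ i, Function.Injective (u i)) {τ : Finset X}
    (hτ : Dominant u τ) (hcard : τ.card + 1 = Fintype.card I) (hne : τ.Nonempty)
    (hint : ∀ a, ∃ y, ∀ i, i ≠ a → ∃ x ∈ τ, u i x < u i y) :
    (Finset.univ.filter fun x => x ∉ τ ∧ Dominant u (insert x τ)).card = 2 := by
  have hm : ∀ i, ∃ m ∈ τ, ∀ x ∈ τ, u i m ≤ u i x := fun i =>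
    Finset.exists_min_image τ (u i) hne
  choose m hmτ hmin using hm
  have hsurj : ∀ t ∈ τ, ∃ i, m i = t := by
    intro t ht
    obtain ⟨i, hi⟩ := hτ t
    exact ⟨i, hu i (le_antisymm (hmin i t ht) (hi _ (hmτ i)))⟩
  obtain ⟨a, -, b, -, hab, hmab⟩ : ∃ a ∈ (Finset.univ : Finset I), ∃ b ∈ Finset.univ,
      a ≠ b ∧ m a = m b :=
    Finset.exists_ne_map_eq_of_card_lt_of_maps_to
      (by rw [Finset.card_univ]; omega) (fun i _ => hmτ i)
  have key : ∀ a b, a ≠ b → m a = m b → ∀ i k, i ≠ a → k ≠ a → m i = m k → i = k := by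
    intro a b hab hmab
    have himg : (Finset.univ.erase a).image m = τ := by
      ext t
      simp only [Finset.mem_image, Finset.mem_erase, Finset.mem_univ, and_true]
      constructor
      · rintro ⟨i, -, rfl⟩
        exact hmτ i
      · intro ht
        obtain ⟨i, rfl⟩ := hsurj t ht
        by_cases hi : i = a
        · exact ⟨b, hab.symm, by rw [hi, hmab]⟩
        · exact ⟨i, hi, rfl⟩
    have hinj : Set.InjOn m (Finset.univ.erase a : Finset I) := by
      rw [← Finset.card_image_iff, himg, Finset.card_erase_of_mem (Finset.mem_univ _),
        Finset.card_univ]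
      omega
    intro i k hi hk h
    exact hinj (by simpa using hi) (by simpa using hk) h
  have hmax : ∀ j, ∃ x, (∀ i, i ≠ j → u i (m i) < u i x) ∧
      ∀ y, (∀ i, i ≠ j → u i (m i) < u i y) → u j y ≤ u j x := by
    intro j
    obtain ⟨y₀, hy₀⟩ := hint j
    obtain ⟨x, hx, hx'⟩ := Finset.exists_max_image
      (Finset.univ.filter fun y => ∀ i, i ≠ j → u i (m i) < u i y) (u j)
      ⟨y₀, by
        simp only [Finset.mem_filter, Finset.mem_univ, true_and]
        intro i hi
        obtain ⟨x, hx, hlt⟩ := hy₀ i hi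
        exact (hmin i x hx).trans_lt hlt⟩
    simp only [Finset.mem_filter, Finset.mem_univ, true_and] at hx hx'
    exact ⟨x, hx, hx'⟩
  choose p hpM hpmax using hmax
  have hmem : ∀ a b, a ≠ b → m a = m b → p a ∉ τ ∧ Dominant u (insert (p a) τ) := by
    intro a b hab hmab
    refine ⟨fun hp => ?_, fun y => ?_⟩
    · obtain ⟨i, hi⟩ := hsurj _ hp
      by_cases hia : i = a
      · have := hpM a b hab.symm
        rw [← hmab, ← hia, hi, hia] at this
        exact lt_irrefl _ this
      · have := hpM a i hia
        rw [hi] at this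
        exact lt_irrefl _ this
    · by_cases hy : ∀ i, i ≠ a → u i (m i) < u i y
      · refine ⟨a, fun x hx => ?_⟩
        rcases Finset.mem_insert.1 hx with rfl | hx
        · exact hpmax a y hy
        · obtain ⟨i, hi⟩ := hτ y
          by_cases hia : i = a
          · exact hia ▸ hi x hx
          · exact absurd (hi _ (hmτ i)) (not_le.2 (hy i hia))
      · push Not at hy
        obtain ⟨i, hia, hi⟩ := hy
        refine ⟨i, fun x hx => ?_⟩
        rcases Finset.mem_insert.1 hx with rfl | hx
        · exact hi.trans (hpM a i hia).le
        · exact hi.trans (hmin i x hx)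
  have hpab : p a ≠ p b := by
    intro h
    obtain ⟨i, hi⟩ := hτ (p a)
    by_cases hia : i = a
    · have := hpM b i (hia ▸ hab)
      rw [← h] at this
      exact absurd (hi _ (hmτ i)) (not_le.2 this)
    · exact absurd (hi _ (hmτ i)) (not_le.2 (hpM a i hia))
  have : (Finset.univ.filter fun x => x ∉ τ ∧ Dominant u (insert x τ)) = {p a, p b} := by
    ext x
    simp only [Finset.mem_filter, Finset.mem_univ, true_and, Finset.mem_insert,
      Finset.mem_singleton]
    constructor
    · rintro ⟨hxτ, hx⟩
      obtain ⟨j, hj⟩ := hx x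
      have hlow : ∀ t ∈ τ, ∃ k, k ≠ j ∧ m k = t ∧ u k t ≤ u k x := by
        intro t ht
        obtain ⟨k, hk⟩ := hx t
        refine ⟨k, ?_, hu k (le_antisymm (hmin k t ht)
          (hk _ (Finset.mem_insert_of_mem (hmτ k)))), hk x (Finset.mem_insert_self _ _)⟩
        rintro rfl
        exact hxτ (hu k (le_antisymm (hj t (Finset.mem_insert_of_mem ht))
          (hk x (Finset.mem_insert_self _ _))) ▸ ht)
      have hjab : j = a ∨ j = b := by
        obtain ⟨k, hkj, hk, -⟩ := hlow (m j) (hmτ j)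
        by_contra! hcon
        by_cases hka : k = a
        · exact hcon.2 (key a b hab hmab j b hcon.1 hab.symm (by rw [← hk, hka, hmab]))
        · exact hkj (key a b hab hmab k j hka hcon.1 hk)
      have hinj : ∀ i k, i ≠ j → k ≠ j → m i = m k → i = k := by
        rcases hjab with rfl | rfl
        · exact key j b hab hmab
        · exact key j a hab.symm hmab.symm
      have hxM : ∀ i, i ≠ j → u i (m i) < u i x := by
        intro i hi
        obtain ⟨k, hkj, hk, hle⟩ := hlow (m i) (hmτ i)
        obtain rfl := hinj k i hkj hi hk
        exact lt_of_le_of_ne hle fun h => hxτ (hu k h ▸ hmτ k)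
      have hxp : x = p j := by
        refine hu j (le_antisymm (hpmax j x hxM) ?_)
        obtain ⟨k, hk⟩ := hx (p j)
        by_cases hkj : k = j
        · exact hkj ▸ hk x (Finset.mem_insert_self _ _)
        · exact absurd (hk _ (Finset.mem_insert_of_mem (hmτ k))) (not_le.2 (hpM j k hkj))
      rcases hjab with rfl | rfl
      · exact Or.inl hxp
      · exact Or.inr hxp
    · rintro (rfl | rfl)
      · exact hmem a b hab hmab
      · exact hmem b a hab.symm hmab.symm
  rw [this, Finset.card_pair hpab]

open Classical in
/-- A set with as many points as there are colours, but missing a colour, has an even number of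
facets whose colours are exactly those different from `i₀`. -/
theorem even_card_facets_of_image_ne_univ {I X : Type*} [Fintype I] (c : X → I) (i₀ : I)
    {S : Finset X} (hS : S.card = Fintype.card I) (hc : S.image c ≠ Finset.univ) :
    Even (S.filter fun x => (S.erase x).image c = Finset.univ.erase i₀).card := by
  rcases (S.filter fun x => (S.erase x).image c = Finset.univ.erase i₀).eq_empty_or_nonempty
    with h | ⟨x, hx⟩
  · simp [h]
  obtain ⟨hxS, hx⟩ := Finset.mem_filter.1 hx
  have himg : ∀ k, (k ∈ (S.erase x).image c ↔ k ≠ i₀) := by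
    intro k; rw [hx]; simp
  have hcx : c x ≠ i₀ := by
    intro h
    apply hc
    ext k
    simp only [Finset.mem_univ, iff_true]
    by_cases hk : k = i₀
    · exact Finset.mem_image.2 ⟨x, hxS, h.trans hk.symm⟩
    · exact Finset.image_subset_image (Finset.erase_subset _ _) ((himg k).2 hk)
  have hinj : Set.InjOn c (S.erase x) := by
    rw [← Finset.card_image_iff, hx, Finset.card_erase_of_mem (Finset.mem_univ _),
      Finset.card_erase_of_mem hxS, hS, Finset.card_univ]
  obtain ⟨x', hx'S, hx'⟩ := Finset.mem_image.1 ((himg _).2 hcx)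
  have hne : x ≠ x' := fun h => by simp [h] at hx'S
  suffices (S.filter fun x => (S.erase x).image c = Finset.univ.erase i₀) = {x, x'} by
    rw [this, Finset.card_pair hne]; exact even_two
  ext y
  simp only [Finset.mem_filter, Finset.mem_insert, Finset.mem_singleton]
  constructor
  · rintro ⟨hyS, hy⟩
    by_contra! hcon
    have hyim : c y ≠ i₀ :=
      (himg _).1 (Finset.mem_image_of_mem _ (Finset.mem_erase.2 ⟨hcon.1, hyS⟩))
    have : c y ∈ (S.erase y).image c := by rw [hy]; simpa using hyim
    obtain ⟨z, hz, hzy⟩ := Finset.mem_image.1 this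
    obtain ⟨hzne, hzS⟩ := Finset.mem_erase.1 hz
    by_cases hzx : z = x
    · exact hcon.2 (hinj (by simp [hcon.1, hyS]) hx'S (by rw [hx', ← hzx, hzy]))
    · exact hzne (hinj (by simp [hzx, hzS]) (by simp [hcon.1, hyS]) hzy)
  · rintro (rfl | rfl)
    · exact ⟨hxS, hx⟩
    · refine ⟨(Finset.mem_erase.1 hx'S).2, ?_⟩
      rw [← hx]
      ext k
      simp only [Finset.mem_image, Finset.mem_erase]
      constructor
      · rintro ⟨z, ⟨hz, hzS⟩, rfl⟩
        by_cases hzx : z = x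
        · exact ⟨y, ⟨hne.symm, (Finset.mem_erase.1 hx'S).2⟩, by rw [hx', hzx]⟩
        · exact ⟨z, ⟨hzx, hzS⟩, rfl⟩
      · rintro ⟨z, ⟨hz, hzS⟩, rfl⟩
        by_cases hzx : z = y
        · exact ⟨x, ⟨hne, hxS⟩, by rw [hzx, hx']⟩
        · exact ⟨z, ⟨hzx, hzS⟩, rfl⟩

open Classical in
/-- If exactly one facet avoiding the colour `i₀` lies on the boundary, and it extends in exactly
one way, then some dominant set carries all colours. -/
theorem exists_dominant_image_eq_univ {I X : Type*} [Fintype I] [Fintype X]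
    {u : I → X → ℕ} (hu : ∀ i, Function.Injective (u i)) (c : X → I) (i₀ : I) (τ₀ : Finset X)
    (hτ₀ : Dominant u τ₀) (hcard₀ : τ₀.card + 1 = Fintype.card I)
    (hc₀ : τ₀.image c = Finset.univ.erase i₀)
    (hone : (Finset.univ.filter fun x => x ∉ τ₀ ∧ Dominant u (insert x τ₀)).card = 1)
    (hint : ∀ τ : Finset X, τ.card + 1 = Fintype.card I → τ.image c = Finset.univ.erase i₀ →
      τ ≠ τ₀ → τ.Nonempty ∧ ∀ a, ∃ y, ∀ i, i ≠ a → ∃ x ∈ τ, u i x < u i y) :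
    ∃ S : Finset X, Dominant u S ∧ S.image c = Finset.univ := by
  by_contra! hcon
  let 𝒞 : Finset (Finset X) :=
    Finset.univ.filter fun S => S.card = Fintype.card I ∧ Dominant u S
  let 𝒟 : Finset (Finset X) := Finset.univ.filter fun τ =>
    τ.card + 1 = Fintype.card I ∧ τ.image c = Finset.univ.erase i₀ ∧ Dominant u τ
  let A := 𝒞.sigma fun S => S.filter fun x => (S.erase x).image c = Finset.univ.erase i₀
  let B := 𝒟.sigma fun τ => Finset.univ.filter fun x => x ∉ τ ∧ Dominant u (insert x τ)
  have hAB : A.card = B.card := by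
    refine Finset.card_bij' (fun q _ => ⟨q.1.erase q.2, q.2⟩) (fun q _ => ⟨insert q.2 q.1, q.2⟩)
      ?_ ?_ ?_ ?_
    · rintro ⟨S, x⟩ hq
      simp only [A, B, 𝒞, 𝒟, Finset.mem_sigma, Finset.mem_filter, Finset.mem_univ,
        true_and] at hq ⊢
      obtain ⟨⟨h1, h2⟩, h3, h4⟩ := hq
      refine ⟨⟨?_, h4, h2.mono (Finset.erase_subset _ _)⟩, Finset.notMem_erase _ _, ?_⟩
      · rw [Finset.card_erase_add_one h3, h1]
      · rwa [Finset.insert_erase h3]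
    · rintro ⟨τ, x⟩ hq
      simp only [A, B, 𝒞, 𝒟, Finset.mem_sigma, Finset.mem_filter, Finset.mem_univ,
        true_and] at hq ⊢
      obtain ⟨⟨h1, h2, h3⟩, h4, h5⟩ := hq
      refine ⟨⟨?_, h5⟩, Finset.mem_insert_self _ _, ?_⟩
      · rw [Finset.card_insert_of_notMem h4, h1]
      · rwa [Finset.erase_insert h4]
    · rintro ⟨S, x⟩ hq
      simp only [A, Finset.mem_sigma, Finset.mem_filter] at hq
      simp only [Finset.insert_erase hq.2.1]
    · rintro ⟨τ, x⟩ hq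
      simp only [B, Finset.mem_sigma, Finset.mem_filter] at hq
      simp only [Finset.erase_insert hq.2.2.1]
  have hA : Even A.card := by
    rw [Finset.card_sigma]
    refine Finset.even_sum _ fun S hS => ?_
    obtain ⟨-, h1, h2⟩ := Finset.mem_filter.1 hS
    exact even_card_facets_of_image_ne_univ c i₀ h1 (hcon S h2)
  have hB : Odd B.card := by
    have hmem : τ₀ ∈ 𝒟 := Finset.mem_filter.2 ⟨Finset.mem_univ _, hcard₀, hc₀, hτ₀⟩
    rw [Finset.card_sigma, ← Finset.add_sum_erase _ _ hmem, hone]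
    refine odd_one.add_even (Finset.even_sum _ fun τ hτ => ?_)
    obtain ⟨hne, hτ⟩ := Finset.mem_erase.1 hτ
    obtain ⟨-, h1, h2, h3⟩ := Finset.mem_filter.1 hτ
    obtain ⟨h4, h5⟩ := hint τ h1 h2 hne
    rw [h3.card_extensions_eq_two hu h1 h4 h5]
    exact even_two
  rw [hAB] at hA
  exact (Nat.not_even_iff_odd.2 hB) hA

/-- The orders `v` on `T`, extended to `T ⊕ I`: the slack point `inr i` is the least element
of the `i`-th order, and is above all of `T` in the others. -/
def slackOrder {I T : Type*} [DecidableEq I] (v : I → T → ℕ) (K : ℕ) (e : I → ℕ) (i : I) :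
    T ⊕ I → ℕ
  | .inl t => v i t + 1
  | .inr j => if j = i then 0 else K + 1 + e j

open Classical in
/-- **Scarf's lemma** for finitely many linear orders on a finite set. -/
theorem exists_colorful_dominant {I T : Type*} [Fintype I] [Nonempty I] [Fintype T] [Nonempty T]
    (v : I → T → ℕ) (hv : ∀ i, Function.Injective (v i)) (c : T → I) :
    ∃ (σ : Finset T) (C : Finset I), σ.Nonempty ∧ (∀ i ∈ C, ∃ t ∈ σ, c t = i) ∧
      ∀ y, ∃ i ∈ C, ∀ x ∈ σ, v i y ≤ v i x := by
  obtain ⟨K, hK⟩ : ∃ K, ∀ i t, v i t < K := by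
    obtain ⟨K, hK⟩ := Set.Finite.bddAbove (Set.finite_range fun q : I × T => v q.1 q.2)
    exact ⟨K + 1, fun i t => Nat.lt_succ_of_le (hK ⟨(i, t), rfl⟩)⟩
  let e : I → ℕ := fun i => Fintype.equivFin I i
  have he : Function.Injective e := fun i j h => by simpa [e, Fin.val_inj] using h
  let u := slackOrder v K e
  have u_inl : ∀ i t, u i (.inl t) = v i t + 1 := fun _ _ => rfl
  have u_inr : ∀ i j, u i (.inr j) = if j = i then 0 else K + 1 + e j := fun _ _ => rfl
  have u_self : ∀ i, u i (.inr i) = 0 := fun i => by simp [u_inr]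
  have u_lt : ∀ i j t, j ≠ i → u i (.inl t) < u i (.inr j) := fun i j t h => by
    rw [u_inl, u_inr, if_neg h]; have := hK i t; omega
  have hu : ∀ i, Function.Injective (u i) := by
    rintro i (t | j) (t' | j') h
    · rw [u_inl, u_inl] at h
      rw [hv i (Nat.succ_injective h)]
    · have := hK i t
      rw [u_inl, u_inr] at h
      split_ifs at h; omega
    · have := hK i t'
      rw [u_inl, u_inr] at h
      split_ifs at h; omega
    · rw [u_inr, u_inr] at h
      split_ifs at h with h1 h2 h2
      · rw [h1, h2]
      · omega
      · omega
      · rw [he (by omega : e j = e j')]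
  obtain ⟨i₀⟩ := ‹Nonempty I›
  let c' : T ⊕ I → I := Sum.elim c id
  let τ₀ : Finset (T ⊕ I) := (Finset.univ.erase i₀).image Sum.inr
  have mem_τ₀ : ∀ x, x ∈ τ₀ ↔ ∃ j, j ≠ i₀ ∧ Sum.inr j = x := fun x => by simp [τ₀]
  have le_τ₀ : ∀ y, (∀ j, j ≠ i₀ → y ≠ .inr j) → ∀ x ∈ τ₀, u i₀ y ≤ u i₀ x := by
    intro y hy x hx
    obtain ⟨j, hj, rfl⟩ := (mem_τ₀ x).1 hx
    rcases y with t | k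
    · exact (u_lt i₀ j t hj).le
    · have : k = i₀ := by
        by_contra hk
        exact hy k hk rfl
      rw [this, u_self]
      exact Nat.zero_le _
  have hτ₀ : Dominant u τ₀ := by
    intro y
    by_cases hy : ∀ j, j ≠ i₀ → y ≠ .inr j
    · exact ⟨i₀, le_τ₀ y hy⟩
    · push Not at hy
      obtain ⟨j, -, rfl⟩ := hy
      exact ⟨j, fun x _ => by rw [u_self]; exact Nat.zero_le _⟩
  have hcard₀ : τ₀.card + 1 = Fintype.card I := by
    rw [Finset.card_image_of_injective _ Sum.inr_injective,
      Finset.card_erase_add_one (Finset.mem_univ _), Finset.card_univ]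
  have hone : (Finset.univ.filter fun x => x ∉ τ₀ ∧ Dominant u (insert x τ₀)).card = 1 := by
    obtain ⟨t, -, ht⟩ := Finset.exists_max_image Finset.univ (v i₀) Finset.univ_nonempty
    rw [Finset.card_eq_one]
    refine ⟨.inl t, ?_⟩
    ext x
    simp only [Finset.mem_filter, Finset.mem_univ, true_and, Finset.mem_singleton]
    constructor
    · rintro ⟨hx, hdom⟩
      obtain ⟨i, hi⟩ := hdom (.inl t)
      have hii : i = i₀ := by
        by_contra hne
        have := hi (.inr i) (Finset.mem_insert_of_mem ((mem_τ₀ _).2 ⟨i, hne, rfl⟩))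
        rw [u_self, u_inl] at this
        omega
      subst hii
      have hle := hi x (Finset.mem_insert_self _ _)
      rcases x with s | k
      · refine hu i (le_antisymm ?_ hle)
        rw [u_inl, u_inl]
        exact Nat.succ_le_succ (ht s (Finset.mem_univ _))
      · by_cases hk : k = i
        · rw [hk, u_self, u_inl] at hle
          omega
        · exact absurd ((mem_τ₀ _).2 ⟨k, hk, rfl⟩) hx
    · rintro rfl
      refine ⟨by simp [mem_τ₀], fun y => ?_⟩
      by_cases hy : ∀ j, j ≠ i₀ → y ≠ .inr j
      · refine ⟨i₀, fun x hx => ?_⟩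
        rcases Finset.mem_insert.1 hx with rfl | hx
        · rcases y with s | k
          · rw [u_inl, u_inl]
            exact Nat.succ_le_succ (ht s (Finset.mem_univ _))
          · have : k = i₀ := by
              by_contra hk
              exact hy k hk rfl
            rw [this, u_self]
            exact Nat.zero_le _
        · exact le_τ₀ y hy x hx
      · push Not at hy
        obtain ⟨j, -, rfl⟩ := hy
        exact ⟨j, fun x _ => by rw [u_self]; exact Nat.zero_le _⟩
  obtain ⟨S, hS, hcS⟩ := exists_dominant_image_eq_univ hu c' i₀ τ₀ hτ₀ hcard₀
    (by simp [τ₀, c', Finset.image_image, Function.comp_def]) (by convert hone) (by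
      intro τ hcard hcol hne
      obtain ⟨t, ht⟩ : ∃ t, Sum.inl t ∈ τ := by
        by_contra! hno
        refine hne (Finset.eq_of_subset_of_card_le (fun x hx => ?_) (by omega))
        rcases x with t | j
        · exact absurd hx (hno t)
        · have : c' (.inr j) ∈ Finset.univ.erase i₀ := hcol ▸ Finset.mem_image_of_mem _ hx
          exact (mem_τ₀ _).2 ⟨j, by simpa [c'] using this, rfl⟩
      exact ⟨⟨_, ht⟩, fun a => ⟨.inr a, fun i hi => ⟨_, ht, u_lt i a t hi.symm⟩⟩⟩)
  have hdom : ∀ y : T, ∃ i, Sum.inr i ∉ S ∧ ∀ x, Sum.inl x ∈ S → v i y ≤ v i x := by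
    intro y
    obtain ⟨i, hi⟩ := hS (.inl y)
    refine ⟨i, fun h => ?_, fun x hx => ?_⟩
    · have := hi _ h
      rw [u_self, u_inl] at this
      omega
    · have := hi _ hx
      rw [u_inl, u_inl] at this
      omega
  have hcol : ∀ i, Sum.inr i ∉ S → ∃ t, Sum.inl t ∈ S ∧ c t = i := by
    intro i hi
    have : i ∈ S.image c' := hcS ▸ Finset.mem_univ i
    obtain ⟨x, hx, hxi⟩ := Finset.mem_image.1 this
    rcases x with t | j
    · exact ⟨t, hx, hxi⟩
    · obtain rfl : j = i := hxi
      exact absurd hx hi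
  refine ⟨Finset.univ.filter fun t => Sum.inl t ∈ S, Finset.univ.filter fun i => Sum.inr i ∉ S,
    ?_, by simpa using hcol, by simpa using hdom⟩
  obtain ⟨i, hi, -⟩ := hdom (Classical.arbitrary T)
  obtain ⟨t, ht, -⟩ := hcol i hi
  exact ⟨t, by simpa using ht⟩

end Scarf

section Brouwer

/-- Scarf's lemma on the grid of points of the simplex with denominator `N`. -/
theorem exists_grid_point_near_colors {I : Type*} [Fintype I] [Nonempty I] (N : ℕ)
    (c : {x : I → Fin (N + 1) // ∑ i, (x i : ℕ) = N} → I) :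
    ∃ z : {x : I → Fin (N + 1) // ∑ i, (x i : ℕ) = N}, ∀ i,
      (z.1 i : ℕ) ≤ Fintype.card I ∨ ∃ x, c x = i ∧ ∀ j,
        (x.1 j : ℕ) ≤ z.1 j + Fintype.card I ∧ (z.1 j : ℕ) ≤ x.1 j + Fintype.card I := by
  classical
  let T := {x : I → Fin (N + 1) // ∑ i, (x i : ℕ) = N}
  have mk : ∀ y : I → ℕ, ∑ i, y i = N → ∃ t : T, ∀ i, (t.1 i : ℕ) = y i := by
    intro y hy
    have hle : ∀ i, y i < N + 1 := fun i => Nat.lt_succ_of_le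
      (hy ▸ Finset.single_le_sum (fun _ _ => Nat.zero_le _) (Finset.mem_univ i))
    exact ⟨⟨fun i => ⟨y i, hle i⟩, hy⟩, fun i => rfl⟩
  have : Nonempty T := by
    obtain ⟨i₀⟩ := ‹Nonempty I›
    obtain ⟨t, -⟩ := mk (fun i => if i = i₀ then N else 0) (by simp)
    exact ⟨t⟩
  let idx := Fintype.equivFin T
  let v : I → T → ℕ := fun i t => (t.1 i : ℕ) * Fintype.card T + idx t
  have hv : ∀ i, Function.Injective (v i) := by
    intro i s t h
    have := congrArg (· % Fintype.card T) h
    simp only [v, Nat.mul_add_mod_self_right, Nat.mod_eq_of_lt (idx _).isLt] at this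
    exact idx.injective (Fin.ext this)
  have hle : ∀ i (s t : T), v i s ≤ v i t → (s.1 i : ℕ) ≤ t.1 i := by
    intro i s t h
    by_contra! hlt
    have h1 : ((t.1 i : ℕ) + 1) * Fintype.card T ≤ (s.1 i : ℕ) * Fintype.card T :=
      Nat.mul_le_mul_right _ hlt
    have h2 := (idx t).isLt
    simp only [v] at h
    rw [add_mul] at h1
    omega
  obtain ⟨σ, C, ⟨z, hz⟩, hcol, hdom⟩ := exists_colorful_dominant v hv c
  have hmin : ∀ i, ∃ s ∈ σ, ∀ x ∈ σ, (s.1 i : ℕ) ≤ x.1 i := fun i =>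
    Finset.exists_min_image σ (fun x : T => (x.1 i : ℕ)) ⟨z, hz⟩
  choose s hsσ hs using hmin
  have hlarge : N < ∑ i ∈ C, (((s i).1 i : ℕ) + 1) := by
    by_contra! hcon
    obtain ⟨i₁, hi₁, -⟩ := hdom z
    obtain ⟨r, hr⟩ := Nat.exists_eq_add_of_le hcon
    obtain ⟨y, hy⟩ := mk
      (fun i => (if i ∈ C then ((s i).1 i : ℕ) + 1 else 0) + if i = i₁ then r else 0) (by
        rw [Finset.sum_add_distrib, Finset.sum_ite_mem]
        simp [← hr])
    obtain ⟨i, hi, hyi⟩ := hdom y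
    have := hle i _ _ (hyi _ (hsσ i))
    rw [hy, if_pos hi] at this
    omega
  rw [Finset.sum_add_distrib, Finset.sum_const, smul_eq_mul, mul_one] at hlarge
  have hC := Finset.card_le_univ C
  have hsplit : ∀ x ∈ σ,
      ∑ i ∈ C, ((x.1 i : ℕ) - (s i).1 i) + ∑ i ∈ Cᶜ, (x.1 i : ℕ) ≤ Fintype.card I := by
    intro x hx
    have h1 : ∑ i ∈ C, ((x.1 i : ℕ) - (s i).1 i) + ∑ i ∈ C, ((s i).1 i : ℕ) =
        ∑ i ∈ C, (x.1 i : ℕ) := by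
      rw [← Finset.sum_add_distrib]
      exact Finset.sum_congr rfl fun i _ => Nat.sub_add_cancel (hs i x hx)
    have h2 := Finset.sum_add_sum_compl C fun i => (x.1 i : ℕ)
    rw [x.2] at h2
    omega
  have hin : ∀ x ∈ σ, ∀ i ∈ C, (x.1 i : ℕ) ≤ (s i).1 i + Fintype.card I := by
    intro x hx i hi
    have h1 := Finset.single_le_sum (f := fun i => (x.1 i : ℕ) - (s i).1 i)
      (fun _ _ => Nat.zero_le _) hi
    have h2 := hsplit x hx
    omega
  have hout : ∀ x ∈ σ, ∀ i, i ∉ C → (x.1 i : ℕ) ≤ Fintype.card I := by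
    intro x hx i hi
    have h1 := Finset.single_le_sum (f := fun i => (x.1 i : ℕ))
      (fun _ _ => Nat.zero_le _) (Finset.mem_compl.2 hi)
    have h2 := hsplit x hx
    omega
  have hnear : ∀ x ∈ σ, ∀ y ∈ σ, ∀ j, (x.1 j : ℕ) ≤ y.1 j + Fintype.card I := by
    intro x hx y hy j
    by_cases hj : j ∈ C
    · have h1 := hin x hx j hj
      have h2 := hs j y hy
      omega
    · have := hout x hx j hj
      omega
  refine ⟨z, fun i => ?_⟩
  by_cases hi : i ∈ C
  · obtain ⟨x, hx, hxi⟩ := hcol i hi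
    exact Or.inr ⟨x, hxi, fun j => ⟨hnear x hx z hz j, hnear z hz x hx j⟩⟩
  · exact Or.inl (hout z hz i hi)

theorem exists_approx_fixedPoint_stdSimplex {I : Type*} [Fintype I] [Nonempty I]
    (g : stdSimplex ℝ I → stdSimplex ℝ I) {N : ℕ} (hN : 0 < N) :
    ∃ z : stdSimplex ℝ I, ∀ i, ∃ w : stdSimplex ℝ I,
      dist w z ≤ Fintype.card I / (N : ℝ) ∧
        (w : I → ℝ) i ≤ (g w : I → ℝ) i + Fintype.card I / (N : ℝ) := by
  have hN' : (0 : ℝ) < N := Nat.cast_pos.2 hN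
  let pt : {x : I → Fin (N + 1) // ∑ i, (x i : ℕ) = N} → stdSimplex ℝ I := fun x =>
    ⟨fun i => ((x.1 i : ℕ) : ℝ) / N, fun i => by positivity, by
      rw [← Finset.sum_div, ← Nat.cast_sum, x.2, div_self hN'.ne']⟩
  have hpt : ∀ x i, (pt x : I → ℝ) i = ((x.1 i : ℕ) : ℝ) / N := fun _ _ => rfl
  have hex : ∀ x : stdSimplex ℝ I, ∃ i, (x : I → ℝ) i ≤ (g x : I → ℝ) i := by
    intro x
    obtain ⟨i, -, hi⟩ := Finset.exists_le_of_sum_le (s := Finset.univ)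
      (f := (x : I → ℝ)) (g := (g x : I → ℝ)) Finset.univ_nonempty
      (by rw [stdSimplex.sum_eq_one, stdSimplex.sum_eq_one])
    exact ⟨i, hi⟩
  choose col hcol using hex
  obtain ⟨z, hz⟩ := exists_grid_point_near_colors N fun x => col (pt x)
  refine ⟨pt z, fun i => ?_⟩
  rcases hz i with h | ⟨x, hx, hxz⟩
  · refine ⟨pt z, by rw [dist_self]; positivity, ?_⟩
    have h1 : (pt z : I → ℝ) i ≤ Fintype.card I / (N : ℝ) := by
      rw [hpt]
      gcongr
    have h2 : 0 ≤ (g (pt z) : I → ℝ) i := (g (pt z)).2.1 i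
    linarith
  · refine ⟨pt x, ?_, ?_⟩
    · rw [Subtype.dist_eq, dist_pi_le_iff (by positivity)]
      intro j
      change dist ((pt x : I → ℝ) j) ((pt z : I → ℝ) j) ≤ _
      rw [hpt, hpt, Real.dist_eq, ← sub_div, abs_div, abs_of_pos hN']
      gcongr
      have h1 : ((x.1 j : ℕ) : ℝ) ≤ (z.1 j : ℕ) + Fintype.card I := by exact_mod_cast (hxz j).1
      have h2 : ((z.1 j : ℕ) : ℝ) ≤ (x.1 j : ℕ) + Fintype.card I := by exact_mod_cast (hxz j).2
      rw [abs_le]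
      constructor <;> linarith
    · have h1 := hcol (pt x)
      rw [hx] at h1
      have h2 : (0 : ℝ) ≤ Fintype.card I / (N : ℝ) := by positivity
      linarith

/-- **Brouwer's fixed point theorem** for the standard simplex. -/
theorem exists_fixedPoint_stdSimplex {I : Type*} [Fintype I] [Nonempty I]
    {g : stdSimplex ℝ I → stdSimplex ℝ I} (hg : Continuous g) : ∃ p, g p = p := by
  have happ := fun k : ℕ => exists_approx_fixedPoint_stdSimplex g (Nat.succ_pos k)
  choose z w hdist hw using happ
  obtain ⟨p, φ, hφ, hp⟩ := CompactSpace.tendsto_subseq z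
  have hsmall : Tendsto (fun k : ℕ => (Fintype.card I : ℝ) / ((φ k).succ : ℕ)) atTop (nhds 0) :=
    (tendsto_const_div_atTop_nhds_zero_nat _).comp
      ((tendsto_add_atTop_nat 1).comp hφ.tendsto_atTop)
  have hle : ∀ i, (p : I → ℝ) i ≤ (g p : I → ℝ) i := by
    intro i
    have hwp : Tendsto (fun k => w (φ k) i) atTop (nhds p) := by
      refine hp.congr_dist (squeeze_zero (fun _ => dist_nonneg) (fun k => ?_) hsmall)
      rw [Function.comp_apply, dist_comm]
      exact hdist _ _
    have hcoord : Continuous fun q : stdSimplex ℝ I => (q : I → ℝ) i :=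
      (continuous_apply i).comp continuous_subtype_val
    have h1 := (hcoord.tendsto p).comp hwp
    have h2 := (((hcoord.comp hg).tendsto p).comp hwp).add hsmall
    rw [add_zero] at h2
    exact le_of_tendsto_of_tendsto' h1 h2 fun k => hw (φ k) i
  refine ⟨p, Subtype.ext (funext fun i => ?_)⟩
  have hsum : ∑ i, (p : I → ℝ) i = ∑ i, (g p : I → ℝ) i := by rw [stdSimplex.sum_eq_one, stdSimplex.sum_eq_one]
  exact ((Finset.sum_eq_sum_iff_of_le fun i _ => hle i).1 hsum i (Finset.mem_univ i)).symm

/-- If continuous functions on the simplex have nonpositive expectation at every point, then they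
are simultaneously nonpositive at some point. -/
theorem exists_forall_nonpos_of_sum_nonpos {I : Type*} [Fintype I] [Nonempty I]
    {f : I → stdSimplex ℝ I → ℝ} (hf : ∀ i, Continuous (f i))
    (hsum : ∀ p : stdSimplex ℝ I, ∑ i, (p : I → ℝ) i * f i p ≤ 0) :
    ∃ p, ∀ i, f i p ≤ 0 := by
  let F : stdSimplex ℝ I → ℝ := fun p => ∑ i, max (f i p) 0
  have hF0 : ∀ p, 0 ≤ F p := fun p => Finset.sum_nonneg fun i _ => le_max_right _ _
  have hFpos : ∀ p, 0 < 1 + F p := fun p => by have := hF0 p; linarith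
  have hFc : Continuous F := continuous_finsetSum _ fun i _ => (hf i).max continuous_const
  let g : stdSimplex ℝ I → stdSimplex ℝ I := fun p =>
    ⟨fun i => ((p : I → ℝ) i + max (f i p) 0) / (1 + F p),
      fun i => div_nonneg (add_nonneg (p.2.1 i) (le_max_right _ _)) (hFpos p).le, by
        rw [← Finset.sum_div, Finset.sum_add_distrib, stdSimplex.sum_eq_one, div_self (hFpos p).ne']⟩
  have hg : Continuous g := by
    refine Continuous.subtype_mk (continuous_pi fun i => ?_) _
    exact (((continuous_apply i).comp continuous_subtype_val).add
      ((hf i).max continuous_const)).div (continuous_const.add hFc) fun p => (hFpos p).ne'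
  obtain ⟨p, hp⟩ := exists_fixedPoint_stdSimplex hg
  have hfix : ∀ i, max (f i p) 0 = (p : I → ℝ) i * F p := by
    intro i
    have : ((p : I → ℝ) i + max (f i p) 0) / (1 + F p) = (p : I → ℝ) i :=
      congrFun (congrArg Subtype.val hp) i
    rw [div_eq_iff (hFpos p).ne'] at this
    linarith
  have hF : F p = 0 := by
    by_contra hne
    have hpos : 0 < F p := lt_of_le_of_ne (hF0 p) (Ne.symm hne)
    have hterm : ∀ i, (p : I → ℝ) i * f i p = (p : I → ℝ) i * max (f i p) 0 := by
      intro i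
      rcases le_total (f i p) 0 with h | h
      · have := hfix i
        rw [max_eq_right h] at this
        have hpi : (p : I → ℝ) i = 0 := (mul_eq_zero.1 this.symm).resolve_right hne
        rw [hpi, zero_mul, zero_mul]
      · rw [max_eq_left h]
    have hsq : ∑ i, (p : I → ℝ) i * max (f i p) 0 = (∑ i, (p : I → ℝ) i ^ 2) * F p := by
      rw [Finset.sum_mul]
      exact Finset.sum_congr rfl fun i _ => by rw [hfix i]; ring
    have hle := hsum p
    rw [Finset.sum_congr rfl fun i _ => hterm i, hsq] at hle
    have hzero : ∑ i, (p : I → ℝ) i ^ 2 = 0 :=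
      le_antisymm (nonpos_of_mul_nonpos_left hle hpos) (Finset.sum_nonneg fun i _ => sq_nonneg _)
    have hpi : ∀ i, (p : I → ℝ) i = 0 := fun i =>
      pow_eq_zero_iff two_ne_zero |>.1
        ((Finset.sum_eq_zero_iff_of_nonneg fun i _ => sq_nonneg _).1 hzero i (Finset.mem_univ i))
    have hone := stdSimplex.sum_eq_one p
    rw [Finset.sum_eq_zero fun i _ => hpi i] at hone
    exact zero_ne_one hone
  refine ⟨p, fun i => ?_⟩
  have := hfix i
  rw [hF, mul_zero] at this
  exact max_eq_right_iff.1 this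

end Brouwer

/-- Lemma 1 of the paper: for any forecast-continuous game-theoretic
supermartingale there is a forecast preventing its growth. -/
theorem supermartingale_defensive_step
    {Ω : Type*} [Fintype Ω] [Nonempty Ω]
    {E : Type*} [Nonempty E]
    (S : List (E × ↥(stdSimplex ℝ Ω) × Ω) → ℝ)
    (hsuper : ∀ (h : List (E × ↥(stdSimplex ℝ Ω) × Ω)) (e : E)
        (π : ↥(stdSimplex ℝ Ω)),
      ∑ ω : Ω, (π : Ω → ℝ) ω * S (h ++ [(e, π, ω)]) ≤ S h)
    (hcont : ∀ (h : List (E × ↥(stdSimplex ℝ Ω) × Ω)) (e : E) (ω : Ω),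
      Continuous (fun π : ↥(stdSimplex ℝ Ω) => S (h ++ [(e, π, ω)]))) :
    ∀ (h : List (E × ↥(stdSimplex ℝ Ω) × Ω)) (e : E),
      ∃ π : ↥(stdSimplex ℝ Ω), ∀ ω : Ω, S (h ++ [(e, π, ω)]) ≤ S h := by
  intro h e
  obtain ⟨π, hπ⟩ := exists_forall_nonpos_of_sum_nonpos
    (f := fun ω π => S (h ++ [(e, π, ω)]) - S h)
    (fun ω => (hcont h e ω).sub continuous_const) (fun π => by
      simp only [mul_sub, Finset.sum_sub_distrib, ← Finset.sum_mul,
        stdSimplex.sum_eq_one, one_mul]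
      exact sub_nonpos.2 (hsuper h e π))
  exact ⟨π, fun ω => sub_nonpos.1 (hπ ω)⟩
end
end

section
/- Let Ω be a finite nonempty set, Λ ⊆ [0,∞]^Ω with superprediction set Σ_Λ, η > 0 a real, and λ : 𝒫(Ω) → Σ_Λ a map such that for every g ∈ Σ_Λ and every π ∈ 𝒫(Ω): E_π (ω ↦ exp(η·λ(π)(ω))·exp(−η·g(ω))) ≤ 1 (the supermartingale property of q_g(π,ω) := exp(η·(λ(π)(ω) − g(ω)))). Then λ is proper with respect to Σ_Λ: for every π ∈ 𝒫(Ω) and every g ∈ Σ_Λ, E_π λ(π) ≤ E_π g. -/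
open scoped ENNReal BigOperators
open Filter

noncomputable section

variable {Ω : Type*} [Fintype Ω]

/-- The tangent-line bound `1 + η (x - y) ≤ exp (η x) exp (-η y)`, rearranged so that it holds
for all `x, y ∈ [0,∞]`. -/
lemma one_add_mul_le_pexp_mul_nexp_add {η : ℝ} (hη : 0 < η) (x y : ℝ≥0∞) :
    1 + ENNReal.ofReal η * x ≤ pexp η x * nexp η y + ENNReal.ofReal η * y := by
  have hη' : ENNReal.ofReal η ≠ 0 := by simpa using hη
  by_cases hy : y = ∞
  · simp [hy, ENNReal.mul_top hη']
  by_cases hx : x = ∞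
  · simp [pexp, nexp, hx, hy, ENNReal.top_mul, Real.exp_pos]
  lift x to NNReal using hx
  lift y to NNReal using hy
  simp only [pexp, nexp, ENNReal.coe_ne_top, if_false, ENNReal.coe_toReal]
  rw [← ENNReal.ofReal_coe_nnreal, ← ENNReal.ofReal_coe_nnreal, ← ENNReal.ofReal_mul hη.le,
    ← ENNReal.ofReal_mul hη.le, ← ENNReal.ofReal_mul (Real.exp_pos _).le, ← Real.exp_add,
    ← ENNReal.ofReal_one, ← ENNReal.ofReal_add zero_le_one (by positivity),
    ← ENNReal.ofReal_add (by positivity) (by positivity)]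
  apply ENNReal.ofReal_le_ofReal
  linarith [Real.add_one_le_exp (η * x + -(η * y))]

lemma expect_mono (π : Ω → ℝ) {f g : Ω → ℝ≥0∞} (h : ∀ ω, f ω ≤ g ω) :
    expect π f ≤ expect π g :=
  Finset.sum_le_sum fun ω _ => mul_le_mul_right (h ω) _

lemma expect_add (π : Ω → ℝ) (f g : Ω → ℝ≥0∞) :
    expect π (fun ω => f ω + g ω) = expect π f + expect π g := by
  simp [expect, mul_add, Finset.sum_add_distrib]

lemma expect_const_mul (π : Ω → ℝ) (c : ℝ≥0∞) (g : Ω → ℝ≥0∞) :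
    expect π (fun ω => c * g ω) = c * expect π g := by
  simp [expect, Finset.mul_sum, mul_left_comm]

lemma expect_one {π : Ω → ℝ} (hπ : π ∈ stdSimplex ℝ Ω) : expect π (fun _ => 1) = 1 := by
  simp [expect, ← ENNReal.ofReal_sum_of_nonneg fun ω _ => hπ.1 ω, hπ.2]

/-- Lemma 5 of the paper: the supermartingale property of `q_g` implies that
`λ` is a proper loss function with respect to `Σ_Λ`. -/
theorem supermartingale_implies_proper
    {Ω : Type*} [Fintype Ω] [Nonempty Ω]
    (Λ : Set (Ω → ℝ≥0∞)) (η : ℝ) (hη : 0 < η)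
    (lam : (Ω → ℝ) → Ω → ℝ≥0∞)
    (hlam : ∀ π ∈ stdSimplex ℝ Ω, lam π ∈ superpred Λ)
    (hqsuper : ∀ g ∈ superpred Λ, ∀ π ∈ stdSimplex ℝ Ω,
      expect π (fun ω => pexp η (lam π ω) * nexp η (g ω)) ≤ 1) :
    ∀ π ∈ stdSimplex ℝ Ω, ∀ g ∈ superpred Λ,
      expect π (lam π) ≤ expect π g := by
  intro π hπ g hg
  have h := expect_mono π fun ω => one_add_mul_le_pexp_mul_nexp_add hη (lam π ω) (g ω)
  rw [expect_add, expect_add, expect_const_mul, expect_const_mul, expect_one hπ] at h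
  have h' := h.trans (add_le_add_left (hqsuper g hg π hπ) _)
  rw [ENNReal.add_le_add_iff_left ENNReal.one_ne_top] at h'
  exact (ENNReal.mul_le_mul_iff_right (by simpa using hη) ENNReal.ofReal_ne_top).mp h'
end
end
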